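/- arXiv:2511.08712 — 2 statements merged into one kernel-verified Lean document; each statement's English description precedes it below -/
import Mathlib

section
/- Let (ℱ_{i,j})_{i,j≥0} be a two-parameter filtration satisfying the (F4) condition. For any adapted sequence (X_{i,j})_{i,j} (i.e. each X_{i,j} is ℱ_{i,j}-measurable), one has the two-sided estimate with universal constants: 𝔼[(Σ_{i,j} X_{i,j}²)^{1/2}] ≃ inf { Σ_{i,j} 𝔼|A_{i,j}| + 𝔼[(Σ_{i,j} 𝔼_{i−1,j−1} B_{i,j}²)^{1/2}] + Σ_i 𝔼[(Σ_j 𝔼_{∞,j−1} C_{i,j}²)^{1/2}] + Σ_j 𝔼[(Σ_i 𝔼_{i−1,∞} D_{i,j}²)^{1/2}] }, where the infimum is taken over all decompositions X_{i,j} = A_{i,j} + B_{i,j} + C_{i,j} + D_{i,j} into sums of adapted sequences. -/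
open MeasureTheory ENNReal

/-- The σ-algebra `ℱ_{i,∞} = ⋁_j ℱ_{i,j}`. -/
def rowSup {Ω : Type*} (𝓕 : ℕ → ℕ → MeasurableSpace Ω) (i : ℕ) : MeasurableSpace Ω :=
  ⨆ j, 𝓕 i j

/-- The σ-algebra `ℱ_{∞,j} = ⋁_i ℱ_{i,j}`. -/
def colSup {Ω : Type*} (𝓕 : ℕ → ℕ → MeasurableSpace Ω) (j : ℕ) : MeasurableSpace Ω :=
  ⨆ i, 𝓕 i j

/-- A two-parameter filtration satisfying the (F4) condition:
`𝔼_{i,j} 𝔼_{k,l} = 𝔼_{min(i,k),min(j,l)} = 𝔼_{k,l} 𝔼_{i,j}` as operators on `L¹`. -/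
structure IsF4Filtration {Ω : Type*} [m0 : MeasurableSpace Ω] (μ : Measure Ω)
    (𝓕 : ℕ → ℕ → MeasurableSpace Ω) : Prop where
  le : ∀ i j, 𝓕 i j ≤ m0
  mono_left : ∀ i j, 𝓕 i j ≤ 𝓕 (i + 1) j
  mono_right : ∀ i j, 𝓕 i j ≤ 𝓕 i (j + 1)
  f4 : ∀ i j k l : ℕ, ∀ f : Ω → ℝ, Integrable f μ →
    μ[μ[f|𝓕 k l]|𝓕 i j] =ᵐ[μ] μ[f|𝓕 (min i k) (min j l)]

/-- The conditional expectation of a nonnegative `ℝ≥0∞`-valued function `g` given `m`,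
defined as the monotone limit of the conditional expectations of the truncations
`min g k`; this extends the usual conditional expectation to possibly non-integrable
nonnegative functions. -/
noncomputable def econdExp {Ω : Type*} [MeasurableSpace Ω] (μ : Measure Ω)
    (m : MeasurableSpace Ω) (g : Ω → ℝ≥0∞) : Ω → ℝ≥0∞ :=
  fun ω => ⨆ k : ℕ, ENNReal.ofReal ((μ[fun a => (min (g a) (k : ℝ≥0∞)).toReal|m]) ω)

/-- The right-hand side of the interpolation-sum decomposition:
`Σ_{i,j} 𝔼|A_{i,j}| + 𝔼[(Σ_{i,j} 𝔼_{i−1,j−1} B_{i,j}²)^{1/2}]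
 + Σ_i 𝔼[(Σ_j 𝔼_{∞,j−1} C_{i,j}²)^{1/2}] + Σ_j 𝔼[(Σ_i 𝔼_{i−1,∞} D_{i,j}²)^{1/2}]`. -/
noncomputable def decompCost {Ω : Type*} [MeasurableSpace Ω] (μ : Measure Ω)
    (𝓕 : ℕ → ℕ → MeasurableSpace Ω) (A B C D : ℕ → ℕ → Ω → ℝ) : ℝ≥0∞ :=
  (∑' (i : ℕ) (j : ℕ), ∫⁻ ω, (‖A i j ω‖₊ : ℝ≥0∞) ∂μ)
    + (∫⁻ ω, (∑' (i : ℕ) (j : ℕ),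
        econdExp μ (𝓕 (i - 1) (j - 1)) (fun a => (‖B i j a‖₊ : ℝ≥0∞) ^ 2) ω) ^ (1/2 : ℝ) ∂μ)
    + (∑' i : ℕ, ∫⁻ ω, (∑' j : ℕ,
        econdExp μ (colSup 𝓕 (j - 1)) (fun a => (‖C i j a‖₊ : ℝ≥0∞) ^ 2) ω) ^ (1/2 : ℝ) ∂μ)
    + (∑' j : ℕ, ∫⁻ ω, (∑' i : ℕ,
        econdExp μ (rowSup 𝓕 (i - 1)) (fun a => (‖D i j a‖₊ : ℝ≥0∞) ^ 2) ω) ^ (1/2 : ℝ) ∂μ)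

section ConditionalExpectation

variable {Ω : Type*} {m m0 : MeasurableSpace Ω} {μ : Measure Ω}

theorem lintegral_mul_le_of_setLIntegral_le (hm : m ≤ m0) {f g : Ω → ℝ≥0∞}
    (hf : Measurable f) (hg : Measurable g)
    (h : ∀ s, MeasurableSet[m] s → ∫⁻ ω in s, f ω ∂μ ≤ ∫⁻ ω in s, g ω ∂μ)
    {φ : Ω → ℝ≥0∞} (hφ : Measurable[m] φ) :
    ∫⁻ ω, φ ω * f ω ∂μ ≤ ∫⁻ ω, φ ω * g ω ∂μ := by
  have key : (μ.withDensity f).trim hm ≤ (μ.withDensity g).trim hm := by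
    refine Measure.le_iff.2 fun s hs => ?_
    rw [trim_measurableSet_eq hm hs, trim_measurableSet_eq hm hs,
      withDensity_apply _ (hm s hs), withDensity_apply _ (hm s hs)]
    exact h s hs
  have hφ' : Measurable φ := hφ.mono hm le_rfl
  have e : ∀ k : Ω → ℝ≥0∞, Measurable k →
      ∫⁻ ω, φ ω * k ω ∂μ = ∫⁻ ω, φ ω ∂((μ.withDensity k).trim hm) := by
    intro k hk
    rw [lintegral_trim hm hφ, lintegral_withDensity_eq_lintegral_mul _ hk hφ']
    exact lintegral_congr fun ω => by simp [mul_comm]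
  rw [e f hf, e g hg]
  exact lintegral_mono' key le_rfl

theorem lintegral_mul_condLExp [IsFiniteMeasure μ] (hm : m ≤ m0) {f : Ω → ℝ≥0∞}
    (hf : Measurable f) {φ : Ω → ℝ≥0∞} (hφ : Measurable[m] φ) :
    ∫⁻ ω, φ ω * μ⁻[f|m] ω ∂μ = ∫⁻ ω, φ ω * f ω ∂μ :=
  le_antisymm
    (lintegral_mul_le_of_setLIntegral_le hm (measurable_condLExp' _ _ _) hf
      (fun _ hs => (setLIntegral_condLExp hm μ f hs).le) hφ)
    (lintegral_mul_le_of_setLIntegral_le hm hf (measurable_condLExp' _ _ _)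
      (fun _ hs => (setLIntegral_condLExp hm μ f hs).ge) hφ)

theorem lintegral_condLExp_mul_comm [IsFiniteMeasure μ] (hm : m ≤ m0) {f g : Ω → ℝ≥0∞}
    (hf : Measurable f) (hg : Measurable g) :
    ∫⁻ ω, μ⁻[g|m] ω * f ω ∂μ = ∫⁻ ω, g ω * μ⁻[f|m] ω ∂μ := by
  rw [← lintegral_mul_condLExp hm hf (measurable_condLExp _ _ _)]
  simp_rw [mul_comm (μ⁻[g|m] _)]
  rw [lintegral_mul_condLExp hm hg (measurable_condLExp _ _ _)]
  simp_rw [mul_comm]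

theorem ae_le_of_setLIntegral_le_sub [IsFiniteMeasure μ] (hm : m ≤ m0) {f g : Ω → ℝ≥0∞}
    (hf : Measurable[m] f) (hg : Measurable[m] g)
    (h : ∀ s, MeasurableSet[m] s → ∫⁻ ω in s, f ω ∂μ ≤ ∫⁻ ω in s, g ω ∂μ) : f ≤ᵐ[μ] g := by
  refine ae_le_of_ae_le_trim (hm := hm) ?_
  refine ae_le_of_forall_setLIntegral_le_of_sigmaFinite hf fun s hs _ => ?_
  rw [setLIntegral_trim hm hf hs, setLIntegral_trim hm hg hs]
  exact h s hs

theorem econdExp_ae_eq_condLExp [IsFiniteMeasure μ] (hm : m ≤ m0) {g : Ω → ℝ≥0∞}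
    (hg : Measurable g) : econdExp μ m g =ᵐ[μ] μ⁻[g|m] := by
  have hk : ∀ k : ℕ, μ⁻[fun a => min (g a) (k : ℝ≥0∞)|m] =ᵐ[μ]
      fun ω => ENNReal.ofReal ((μ[fun a => (min (g a) (k : ℝ≥0∞)).toReal|m]) ω) := by
    intro k
    have hmeas : Measurable fun a => min (g a) (k : ℝ≥0∞) := hg.min measurable_const
    have hfin : ∫⁻ a, min (g a) (k : ℝ≥0∞) ∂μ ≠ ∞ := by
      refine ne_top_of_le_ne_top ?_ (lintegral_mono fun a => min_le_right (g a) (k : ℝ≥0∞))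
      simp [ENNReal.mul_eq_top]
    have := condLExp_ofReal m (μ := μ) (integrable_toReal_of_lintegral_ne_top
      hmeas.aemeasurable hfin) (Filter.Eventually.of_forall fun _ => ENNReal.toReal_nonneg)
    refine Filter.EventuallyEq.trans (Filter.EventuallyEq.of_eq ?_) this
    congr 1
    funext a
    rw [ENNReal.ofReal_toReal]
    exact ne_top_of_le_ne_top (by simp) (min_le_right (g a) (k : ℝ≥0∞))
  have hE : econdExp μ m g =ᵐ[μ] fun ω => ⨆ k : ℕ, μ⁻[fun a => min (g a) (k : ℝ≥0∞)|m] ω := by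
    filter_upwards [ae_all_iff.2 hk] with ω hω
    simp only [econdExp]
    exact iSup_congr fun k => (hω k).symm
  refine hE.trans (ae_eq_condLExp hm _ _ ?_ ?_)
  · exact Measurable.iSup fun k => measurable_condLExp m μ _
  · intro s hs
    have hmono : ∀ᵐ ω ∂μ, Monotone fun k : ℕ => μ⁻[fun a => min (g a) (k : ℝ≥0∞)|m] ω := by
      have : ∀ k : ℕ, μ⁻[fun a => min (g a) (k : ℝ≥0∞)|m] ≤ᵐ[μ]
          μ⁻[fun a => min (g a) ((k + 1 : ℕ) : ℝ≥0∞)|m] := fun k =>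
        condLExp_mono (Filter.Eventually.of_forall fun a => min_le_min le_rfl (by simp))
      filter_upwards [ae_all_iff.2 this] with ω hω
      exact monotone_nat_of_le_succ hω
    rw [lintegral_iSup' (fun k => (measurable_condLExp' m μ _).aemeasurable)
      (ae_restrict_of_ae hmono)]
    simp_rw [setLIntegral_condLExp hm μ _ hs]
    rw [← lintegral_iSup (fun k => hg.min measurable_const)
      (fun a b hab ω => min_le_min le_rfl (by exact_mod_cast hab))]
    refine lintegral_congr fun ω => ?_
    refine le_antisymm (iSup_le fun k => min_le_left _ _) ?_
    by_cases htop : g ω = ∞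
    · simp [htop, ENNReal.iSup_natCast]
    · obtain ⟨k, hk⟩ := ENNReal.exists_nat_gt htop
      exact le_iSup_of_le k (by simp [hk.le])

end ConditionalExpectation

section F4

variable {Ω : Type*} [m0 : MeasurableSpace Ω] {μ : Measure Ω} {𝓕 : ℕ → ℕ → MeasurableSpace Ω}

theorem IsF4Filtration.swap (h : IsF4Filtration μ 𝓕) : IsF4Filtration μ fun i j => 𝓕 j i where
  le i j := h.le j i
  mono_left i j := h.mono_right j i
  mono_right i j := h.mono_left j i
  f4 i j k l f hf := h.f4 j i l k f hf

theorem IsF4Filtration.mono (h : IsF4Filtration μ 𝓕) {i k j l : ℕ} (hik : i ≤ k) (hjl : j ≤ l) :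
    𝓕 i j ≤ 𝓕 k l :=
  (monotone_nat_of_le_succ (f := fun i => 𝓕 i j) (fun i => h.mono_left i j) hik).trans
    (monotone_nat_of_le_succ (f := fun j => 𝓕 k j) (fun j => h.mono_right k j) hjl)

theorem IsF4Filtration.colSup_le (h : IsF4Filtration μ 𝓕) (j : ℕ) : colSup 𝓕 j ≤ m0 :=
  iSup_le fun i => h.le i j

theorem IsF4Filtration.rowSup_le (h : IsF4Filtration μ 𝓕) (i : ℕ) : rowSup 𝓕 i ≤ m0 :=
  iSup_le fun j => h.le i j

theorem le_colSup (𝓕 : ℕ → ℕ → MeasurableSpace Ω) (i j : ℕ) : 𝓕 i j ≤ colSup 𝓕 j :=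
  le_iSup (fun i => 𝓕 i j) i

theorem le_rowSup (𝓕 : ℕ → ℕ → MeasurableSpace Ω) (i j : ℕ) : 𝓕 i j ≤ rowSup 𝓕 i :=
  le_iSup (fun j => 𝓕 i j) j

theorem IsF4Filtration.colSup_mono (h : IsF4Filtration μ 𝓕) : Monotone (colSup 𝓕) :=
  fun _ _ hjl => iSup_mono fun _ => h.mono le_rfl hjl

theorem IsF4Filtration.rowSup_mono (h : IsF4Filtration μ 𝓕) : Monotone (rowSup 𝓕) :=
  fun _ _ hik => iSup_mono fun _ => h.mono hik le_rfl

variable [IsProbabilityMeasure μ]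

theorem IsF4Filtration.condExp_condExp_colSup (h : IsF4Filtration μ 𝓕) (i l j : ℕ) (hjl : j ≤ l)
    {f : Ω → ℝ} (hf : Integrable f μ) :
    μ[μ[f|colSup 𝓕 j]|𝓕 i l] =ᵐ[μ] μ[f|𝓕 i j] := by
  let ℱ : Filtration ℕ m0 :=
    ⟨fun k => 𝓕 k j, fun _ _ hk => h.mono hk le_rfl, fun k => h.le k j⟩
  have hlim : Filter.Tendsto (fun k => eLpNorm (μ[f|𝓕 k j] - μ[f|colSup 𝓕 j]) 1 μ) Filter.atTop
      (nhds 0) := tendsto_eLpNorm_condExp (ℱ := ℱ) f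
  have hle : ∀ᶠ k in Filter.atTop, eLpNorm (μ[f|𝓕 i j] - μ[μ[f|colSup 𝓕 j]|𝓕 i l]) 1 μ ≤
      eLpNorm (μ[f|𝓕 k j] - μ[f|colSup 𝓕 j]) 1 μ := by
    filter_upwards [Filter.eventually_ge_atTop i] with k hk
    have h1 : μ[μ[f|𝓕 k j]|𝓕 i l] =ᵐ[μ] μ[f|𝓕 i j] := by
      simpa [min_eq_left hk, min_eq_right hjl] using h.f4 i l k j f hf
    have h2 : μ[μ[f|𝓕 k j] - μ[f|colSup 𝓕 j]|𝓕 i l] =ᵐ[μ]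
        μ[f|𝓕 i j] - μ[μ[f|colSup 𝓕 j]|𝓕 i l] :=
      (condExp_sub integrable_condExp integrable_condExp _).trans (h1.sub (Filter.EventuallyEq.rfl))
    rw [← eLpNorm_congr_ae h2]
    exact eLpNorm_condExp_le_eLpNorm _ le_rfl
  have h0 : eLpNorm (μ[f|𝓕 i j] - μ[μ[f|colSup 𝓕 j]|𝓕 i l]) 1 μ = 0 :=
    le_antisymm (ge_of_tendsto hlim hle) zero_le
  rw [eLpNorm_eq_zero_iff (integrable_condExp.sub integrable_condExp).aestronglyMeasurable
    one_ne_zero] at h0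
  filter_upwards [h0] with ω hω
  have : (μ[f|𝓕 i j]) ω - (μ[μ[f|colSup 𝓕 j]|𝓕 i l]) ω = 0 := hω
  linarith

theorem IsF4Filtration.condExp_colSup_rowSup (h : IsF4Filtration μ 𝓕) (i j : ℕ)
    {f : Ω → ℝ} (hf : Integrable f μ) :
    μ[μ[f|colSup 𝓕 j]|rowSup 𝓕 i] =ᵐ[μ] μ[f|𝓕 i j] := by
  let ℱ : Filtration ℕ m0 :=
    ⟨fun l => 𝓕 i l, fun _ _ hk => h.mono le_rfl hk, fun l => h.le i l⟩
  have hlim : ∀ᵐ ω ∂μ, Filter.Tendsto (fun l => (μ[μ[f|colSup 𝓕 j]|𝓕 i l]) ω) Filter.atTop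
      (nhds ((μ[μ[f|colSup 𝓕 j]|rowSup 𝓕 i]) ω)) := tendsto_ae_condExp (ℱ := ℱ) _
  have hev : ∀ᵐ ω ∂μ, ∀ l, j ≤ l → (μ[μ[f|colSup 𝓕 j]|𝓕 i l]) ω = (μ[f|𝓕 i j]) ω := by
    refine ae_all_iff.2 fun l => ?_
    by_cases hl : j ≤ l
    · filter_upwards [h.condExp_condExp_colSup i l j hl hf] with ω hω _ using hω
    · exact Filter.Eventually.of_forall fun ω hl' => absurd hl' hl
  filter_upwards [hlim, hev] with ω h1 h2
  refine tendsto_nhds_unique h1 (tendsto_const_nhds.congr' ?_)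
  filter_upwards [Filter.eventually_ge_atTop j] with l hl using (h2 l hl).symm

theorem IsF4Filtration.condExp_rowSup_colSup (h : IsF4Filtration μ 𝓕) (i j : ℕ)
    {f : Ω → ℝ} (hf : Integrable f μ) :
    μ[μ[f|rowSup 𝓕 i]|colSup 𝓕 j] =ᵐ[μ] μ[f|𝓕 i j] :=
  h.swap.condExp_colSup_rowSup j i hf

theorem IsF4Filtration.setLIntegral_condLExp_colSup (h : IsF4Filtration μ 𝓕) (i j : ℕ)
    {f : Ω → ℝ≥0∞} (hf : Measurable f) {s : Set Ω} (hs : MeasurableSet[rowSup 𝓕 i] s) :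
    ∫⁻ ω in s, μ⁻[f|colSup 𝓕 j] ω ∂μ = ∫⁻ ω in s, μ⁻[f|𝓕 i j] ω ∂μ := by
  have hs0 : MeasurableSet s := h.rowSup_le i s hs
  have hmeas : Measurable (s.indicator (1 : Ω → ℝ≥0∞)) := measurable_one.indicator hs0
  have h_int : Integrable (s.indicator (1 : Ω → ℝ)) μ :=
    (integrable_const (1 : ℝ)).indicator hs0
  have hof : (fun ω => ENNReal.ofReal (s.indicator (1 : Ω → ℝ) ω)) =
      s.indicator (1 : Ω → ℝ≥0∞) := by
    funext ω
    by_cases hω : ω ∈ s <;> simp [hω]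
  have hreal : μ[s.indicator (1 : Ω → ℝ)|colSup 𝓕 j] =ᵐ[μ] μ[s.indicator (1 : Ω → ℝ)|𝓕 i j] := by
    have := h.condExp_rowSup_colSup i j h_int
    rwa [condExp_of_stronglyMeasurable (h.rowSup_le i)
      (StronglyMeasurable.indicator stronglyMeasurable_one hs) h_int] at this
  have hL : ∀ m : MeasurableSpace Ω, μ⁻[s.indicator (1 : Ω → ℝ≥0∞)|m] =ᵐ[μ]
      fun ω => ENNReal.ofReal ((μ[s.indicator (1 : Ω → ℝ)|m]) ω) := by
    intro m
    rw [← hof]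
    exact condLExp_ofReal m h_int (Filter.Eventually.of_forall fun ω =>
      Set.indicator_nonneg (fun _ _ => zero_le_one) ω)
  have hE : μ⁻[s.indicator (1 : Ω → ℝ≥0∞)|colSup 𝓕 j] =ᵐ[μ]
      μ⁻[s.indicator (1 : Ω → ℝ≥0∞)|𝓕 i j] := by
    filter_upwards [hL (colSup 𝓕 j), hL (𝓕 i j), hreal] with ω h1 h2 h3
    rw [h1, h2, h3]
  have hset : ∀ g : Ω → ℝ≥0∞, ∫⁻ ω in s, g ω ∂μ =
      ∫⁻ ω, s.indicator (1 : Ω → ℝ≥0∞) ω * g ω ∂μ := by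
    intro g
    rw [← lintegral_indicator hs0]
    refine lintegral_congr fun ω => ?_
    by_cases hω : ω ∈ s <;> simp [hω]
  rw [hset, hset, ← lintegral_condLExp_mul_comm (h.colSup_le j) hf hmeas,
    ← lintegral_condLExp_mul_comm (h.le i j) hf hmeas]
  refine lintegral_congr_ae ?_
  filter_upwards [hE] with ω hω
  rw [hω]

end F4

theorem two_mul_sqrt_add_div_sqrt_le {a g : ℝ≥0∞} (ha : a ≠ 0) :
    2 * a ^ (1/2 : ℝ) + g * (a + g) ^ (-(1/2) : ℝ) ≤ 2 * (a + g) ^ (1/2 : ℝ) := by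
  by_cases hat : a = ∞
  · simp [hat]
  by_cases hgt : g = ∞
  · simp [hgt]
  lift a to NNReal using hat
  lift g to NNReal using hgt
  have ha' : 0 < a := pos_iff_ne_zero.2 (by exact_mod_cast ha)
  have hs : a + g ≠ 0 := (add_pos_of_pos_of_nonneg ha' zero_le).ne'
  rw [← ENNReal.coe_add, ← ENNReal.coe_rpow_of_ne_zero hs,
    ← ENNReal.coe_rpow_of_ne_zero ha'.ne', ← ENNReal.coe_rpow_of_ne_zero hs]
  norm_cast
  rw [← NNReal.coe_le_coe]
  push_cast
  have hsr : (0 : ℝ) < a + g := by exact_mod_cast pos_iff_ne_zero.2 hs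
  rw [Real.rpow_neg hsr.le, ← Real.sqrt_eq_rpow, ← Real.sqrt_eq_rpow]
  have hb := Real.sqrt_pos.2 hsr
  have h1 := Real.sq_sqrt hsr.le
  have h2 := Real.sq_sqrt a.2
  rw [← div_eq_mul_inv, ← le_sub_iff_add_le', div_le_iff₀ hb]
  change √(a : ℝ) ^ 2 = a at h2
  nlinarith [sq_nonneg (√(a : ℝ) - √((a : ℝ) + g))]

theorem sum_mul_rpow_neg_half_le {ε : ℝ≥0∞} (hε : ε ≠ 0) (g : ℕ → ℝ≥0∞) (n : ℕ) :
    ∑ j ∈ Finset.range n, g j * (ε + ∑ l ∈ Finset.range (j + 1), g l) ^ (-(1/2) : ℝ) ≤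
      2 * (ε + ∑ l ∈ Finset.range n, g l) ^ (1/2 : ℝ) := by
  induction n with
  | zero => simp
  | succ n ih =>
    rw [Finset.sum_range_succ]
    have hne : ε + ∑ l ∈ Finset.range n, g l ≠ 0 := by simp [hε]
    have := two_mul_sqrt_add_div_sqrt_le (g := g n) hne
    rw [add_assoc, ← Finset.sum_range_succ] at this
    exact (add_le_add ih le_rfl).trans this

theorem tsum_mul_rpow_neg_half_le {ε : ℝ≥0∞} (hε : ε ≠ 0) (g : ℕ → ℝ≥0∞) :
    ∑' j, g j * (ε + ∑ l ∈ Finset.range (j + 1), g l) ^ (-(1/2) : ℝ) ≤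
      2 * (ε + ∑' l, g l) ^ (1/2 : ℝ) := by
  rw [ENNReal.tsum_eq_iSup_nat]
  refine iSup_le fun n => (sum_mul_rpow_neg_half_le hε g n).trans ?_
  gcongr
  exact ENNReal.sum_le_tsum _

theorem rpow_half_mul_le (x y : ℝ≥0∞) :
    (x * y) ^ (1/2 : ℝ) ≤ (x + y) := by
  calc (x * y) ^ (1/2 : ℝ) ≤ ((x + y) * (x + y)) ^ (1/2 : ℝ) := by
        gcongr <;> simp
    _ = x + y := by
        rw [← sq, ← ENNReal.rpow_natCast, ← ENNReal.rpow_mul]; norm_num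

theorem rpow_half_tsum_le (f g : ℕ → ℝ≥0∞) {ε : ℝ≥0∞} (hε : ε ≠ 0) (hεt : ε ≠ ∞)
    (hg : ∑' j, g j ≠ ∞) :
    (∑' j, f j) ^ (1/2 : ℝ) ≤
      ∑' j, (ε + ∑ l ∈ Finset.range (j + 1), g l) ^ (-(1/2) : ℝ) * f j
        + (ε + ∑' j, g j) ^ (1/2 : ℝ) := by
  refine le_trans ?_ (rpow_half_mul_le _ _)
  gcongr
  rw [← ENNReal.tsum_mul_right]
  refine ENNReal.tsum_le_tsum fun j => ?_
  have hle : ε + ∑ l ∈ Finset.range (j + 1), g l ≤ ε + ∑' j, g j := by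
    gcongr; exact ENNReal.sum_le_tsum _
  have h0 : ε + ∑ l ∈ Finset.range (j + 1), g l ≠ 0 := by simp [hε]
  have ht : ε + ∑ l ∈ Finset.range (j + 1), g l ≠ ∞ :=
    ne_top_of_le_ne_top (ENNReal.add_ne_top.2 ⟨hεt, hg⟩) hle
  calc f j = (ε + ∑ l ∈ Finset.range (j + 1), g l) ^ (-(1/2) : ℝ) * f j *
        (ε + ∑ l ∈ Finset.range (j + 1), g l) ^ (1/2 : ℝ) := by
        rw [mul_right_comm, ← ENNReal.rpow_add _ _ h0 ht]; simp
    _ ≤ _ := by gcongr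

/-- For increasing σ-algebras `G`, nonnegative functions are controlled in `L^{1/2}(ℓ¹)` by their
predictable projections, or by any predictable functions dominating these. -/
theorem lintegral_rpow_half_tsum_le {Ω : Type*} [m0 : MeasurableSpace Ω] {μ : Measure Ω}
    [IsProbabilityMeasure μ] {G : ℕ → MeasurableSpace Ω} (hG : Monotone G) (hle : ∀ j, G j ≤ m0)
    {f g : ℕ → Ω → ℝ≥0∞} (hf : ∀ j, Measurable (f j)) (hg : ∀ j, Measurable[G j] (g j))
    (hfg : ∀ j, ∀ φ : Ω → ℝ≥0∞, Measurable[G j] φ →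
      ∫⁻ ω, φ ω * f j ω ∂μ ≤ ∫⁻ ω, φ ω * g j ω ∂μ) :
    ∫⁻ ω, (∑' j, f j ω) ^ (1/2 : ℝ) ∂μ ≤ 3 * ∫⁻ ω, (∑' j, g j ω) ^ (1/2 : ℝ) ∂μ := by
  have hg' : ∀ j, Measurable (g j) := fun j => (hg j).mono (hle j) le_rfl
  by_cases hfin : ∫⁻ ω, (∑' j, g j ω) ^ (1/2 : ℝ) ∂μ = ∞
  · rw [hfin]; simp
  have hGtm : Measurable fun ω => ∑' j, g j ω := Measurable.tsum hg'
  have hae : ∀ᵐ ω ∂μ, ∑' j, g j ω ≠ ∞ := by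
    filter_upwards [ae_lt_top (hGtm.pow_const _) hfin] with ω hω htop
    simp [htop] at hω
  have main : ∀ ε : NNReal, ε ≠ 0 → ∫⁻ ω, (∑' j, f j ω) ^ (1/2 : ℝ) ∂μ ≤
      3 * (∫⁻ ω, (∑' j, g j ω) ^ (1/2 : ℝ) ∂μ + (ε : ℝ≥0∞) ^ (1/2 : ℝ)) := by
    intro ε hε
    have hε0 : (ε : ℝ≥0∞) ≠ 0 := by exact_mod_cast hε
    have hw : ∀ j, Measurable[G j] fun ω =>
        ((ε : ℝ≥0∞) + ∑ l ∈ Finset.range (j + 1), g l ω) ^ (-(1/2) : ℝ) := by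
      intro j
      refine Measurable.pow_const (Measurable.const_add ?_ _) _
      exact Finset.measurable_fun_sum _ fun l hl =>
        (hg l).mono (hG (by simpa [Nat.lt_succ_iff] using hl)) le_rfl
    have hw' := fun j => (hw j).mono (hle j) le_rfl
    calc ∫⁻ ω, (∑' j, f j ω) ^ (1/2 : ℝ) ∂μ
        ≤ ∫⁻ ω, (∑' j, ((ε : ℝ≥0∞) + ∑ l ∈ Finset.range (j + 1), g l ω) ^ (-(1/2) : ℝ) * f j ω
          + ((ε : ℝ≥0∞) + ∑' j, g j ω) ^ (1/2 : ℝ)) ∂μ := by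
          refine lintegral_mono_ae ?_
          filter_upwards [hae] with ω hω
          exact rpow_half_tsum_le _ _ hε0 ENNReal.coe_ne_top hω
      _ = ∑' j, ∫⁻ ω, ((ε : ℝ≥0∞) + ∑ l ∈ Finset.range (j + 1), g l ω) ^ (-(1/2) : ℝ) * f j ω ∂μ
          + ∫⁻ ω, ((ε : ℝ≥0∞) + ∑' j, g j ω) ^ (1/2 : ℝ) ∂μ := by
          rw [lintegral_add_right _ ((hGtm.const_add _).pow_const _),
            lintegral_tsum fun j => ((hw' j).fun_mul (hf j)).aemeasurable]
      _ ≤ ∑' j, ∫⁻ ω, ((ε : ℝ≥0∞) + ∑ l ∈ Finset.range (j + 1), g l ω) ^ (-(1/2) : ℝ) * g j ω ∂μ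
          + ∫⁻ ω, ((ε : ℝ≥0∞) + ∑' j, g j ω) ^ (1/2 : ℝ) ∂μ := by
          exact add_le_add (ENNReal.tsum_le_tsum fun j => hfg j _ (hw j)) le_rfl
      _ = ∫⁻ ω, ∑' j, g j ω * ((ε : ℝ≥0∞) + ∑ l ∈ Finset.range (j + 1), g l ω) ^ (-(1/2) : ℝ) ∂μ
          + ∫⁻ ω, ((ε : ℝ≥0∞) + ∑' j, g j ω) ^ (1/2 : ℝ) ∂μ := by
          rw [lintegral_tsum fun j => ((hg' j).fun_mul (hw' j)).aemeasurable]
          simp_rw [mul_comm]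
      _ ≤ ∫⁻ ω, 2 * ((ε : ℝ≥0∞) + ∑' j, g j ω) ^ (1/2 : ℝ) ∂μ
          + ∫⁻ ω, ((ε : ℝ≥0∞) + ∑' j, g j ω) ^ (1/2 : ℝ) ∂μ := by
          gcongr with ω
          exact tsum_mul_rpow_neg_half_le hε0 _
      _ = 3 * ∫⁻ ω, ((ε : ℝ≥0∞) + ∑' j, g j ω) ^ (1/2 : ℝ) ∂μ := by
          rw [lintegral_const_mul _ ((hGtm.const_add _).pow_const _)]
          ring
      _ ≤ 3 * ∫⁻ ω, ((∑' j, g j ω) ^ (1/2 : ℝ) + (ε : ℝ≥0∞) ^ (1/2 : ℝ)) ∂μ := by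
          gcongr with ω
          rw [add_comm]
          exact ENNReal.rpow_add_le_add_rpow _ _ (by norm_num) (by norm_num)
      _ = _ := by
          rw [lintegral_add_right _ measurable_const]
          simp
  have hlim : Filter.Tendsto (fun ε : NNReal =>
      3 * (∫⁻ ω, (∑' j, g j ω) ^ (1/2 : ℝ) ∂μ + (ε : ℝ≥0∞) ^ (1/2 : ℝ))) (nhdsWithin 0 {0}ᶜ)
      (nhds (3 * (∫⁻ ω, (∑' j, g j ω) ^ (1/2 : ℝ) ∂μ + ((0 : NNReal) : ℝ≥0∞) ^ (1/2 : ℝ)))) := by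
    refine Filter.Tendsto.mono_left (Continuous.tendsto ?_ 0) nhdsWithin_le_nhds
    refine (ENNReal.continuous_const_mul (by simp)).comp (continuous_const.add ?_)
    exact ENNReal.continuous_rpow_const.comp ENNReal.continuous_coe
  have := ge_of_tendsto hlim (Filter.eventually_of_mem self_mem_nhdsWithin fun ε hε => main ε hε)
  simpa using this

theorem sq_add_tsub_le (m v : ℝ≥0∞) : (m + (v - m)) ^ 2 ≤ m ^ 2 + 2 * ((v - m) * v) := by
  rcases le_total v m with h | h
  · simp [tsub_eq_zero_of_le h]
  · obtain ⟨d, rfl⟩ := exists_add_of_le h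
    rw [add_tsub_cancel_of_le h]
    by_cases hm : m = ∞
    · simp [hm]
    rw [ENNReal.add_sub_cancel_left hm]
    calc (m + d) ^ 2 ≤ (m + d) ^ 2 + d ^ 2 := le_self_add
      _ = m ^ 2 + 2 * (d * (m + d)) := by ring

theorem two_mul_le_half_sq_add (x y : ℝ≥0∞) : 2 * (x * y) ≤ x ^ 2 / 2 + 2 * y ^ 2 := by
  by_cases hx : x = ∞
  · simp [hx, ENNReal.top_div]
  by_cases hy : y = ∞
  · simp [hy]
  lift x to NNReal using hx
  lift y to NNReal using hy
  have : ((x : ℝ≥0∞) ^ 2 / 2) = ((x ^ 2 / 2 : NNReal) : ℝ≥0∞) := by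
    rw [ENNReal.coe_div two_ne_zero]; simp
  rw [this]
  norm_cast
  rw [← NNReal.coe_le_coe]
  push_cast
  nlinarith [sq_nonneg ((x : ℝ) - 2 * y)]

theorem measurable_partialSups {Ω : Type*} [MeasurableSpace Ω] {v : ℕ → Ω → ℝ≥0∞}
    (hv : ∀ j, Measurable (v j)) (n : ℕ) :
    Measurable fun ω => partialSups (fun j => v j ω) n := by
  induction n with
  | zero => simpa using hv 0
  | succ n ih =>
    simp_rw [partialSups_add_one]
    exact ih.max (hv (n + 1))

section Doob

variable {Ω : Type*} [m0 : MeasurableSpace Ω] {μ : Measure Ω} [IsProbabilityMeasure μ]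
  {G : ℕ → MeasurableSpace Ω}

theorem lintegral_partialSups_sq_le (hG : Monotone G)
    (hle : ∀ j, G j ≤ m0) {v : ℕ → Ω → ℝ≥0∞} {f : Ω → ℝ≥0∞} (hf : Measurable f)
    (hv : ∀ j, Measurable[G j] (v j))
    (hvf : ∀ j, ∀ φ : Ω → ℝ≥0∞, Measurable[G j] φ →
      ∫⁻ ω, φ ω * v j ω ∂μ ≤ ∫⁻ ω, φ ω * f ω ∂μ) (n : ℕ) :
    ∫⁻ ω, (partialSups (fun j => v j ω) n) ^ 2 ∂μ ≤
      2 * ∫⁻ ω, partialSups (fun j => v j ω) n * f ω ∂μ := by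
  have hM : ∀ n, Measurable[G n] fun ω => partialSups (fun j => v j ω) n := by
    intro n
    induction n with
    | zero => simpa using hv 0
    | succ n ih =>
      simp_rw [partialSups_add_one]
      exact Measurable.max (ih.mono (hG n.le_succ) le_rfl) (hv (n + 1))
  have hM' := fun n => (hM n).mono (hle n) le_rfl
  have hv' := fun n => (hv n).mono (hle n) le_rfl
  induction n with
  | zero =>
    simp only [partialSups_zero]
    calc ∫⁻ ω, v 0 ω ^ 2 ∂μ = ∫⁻ ω, v 0 ω * v 0 ω ∂μ := by simp_rw [sq]
      _ ≤ ∫⁻ ω, v 0 ω * f ω ∂μ := hvf 0 _ (hv 0)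
      _ ≤ _ := by rw [two_mul]; exact le_self_add
  | succ n ih =>
    have hsup : ∀ ω, partialSups (fun j => v j ω) (n + 1) = partialSups (fun j => v j ω) n +
        (v (n + 1) ω - partialSups (fun j => v j ω) n) := fun ω => by
      rw [partialSups_add_one, add_tsub_eq_max]
    have hd : Measurable[G (n + 1)] fun ω => v (n + 1) ω - partialSups (fun j => v j ω) n :=
      Measurable.sub (hv (n + 1)) ((hM n).mono (hG n.le_succ) le_rfl)
    have hd' := hd.mono (hle (n + 1)) le_rfl
    simp_rw [hsup]
    calc ∫⁻ ω, (partialSups (fun j => v j ω) n +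
          (v (n + 1) ω - partialSups (fun j => v j ω) n)) ^ 2 ∂μ
        ≤ ∫⁻ ω, ((partialSups (fun j => v j ω) n) ^ 2 + 2 *
          ((v (n + 1) ω - partialSups (fun j => v j ω) n) * v (n + 1) ω)) ∂μ :=
          lintegral_mono fun ω => sq_add_tsub_le _ _
      _ = ∫⁻ ω, (partialSups (fun j => v j ω) n) ^ 2 ∂μ + 2 *
          ∫⁻ ω, (v (n + 1) ω - partialSups (fun j => v j ω) n) * v (n + 1) ω ∂μ := by
          rw [lintegral_add_left ((hM' n).pow_const _), lintegral_const_mul _ (hd'.fun_mul (hv' _))]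
      _ ≤ 2 * ∫⁻ ω, partialSups (fun j => v j ω) n * f ω ∂μ + 2 *
          ∫⁻ ω, (v (n + 1) ω - partialSups (fun j => v j ω) n) * f ω ∂μ := by
          gcongr ?_ + 2 * ?_
          exact hvf (n + 1) _ hd
      _ = _ := by
          rw [← mul_add, ← lintegral_add_left ((hM' n).fun_mul hf)]
          simp_rw [add_mul]

/-- Doob's `L²` maximal inequality. -/
theorem lintegral_iSup_sq_le (hG : Monotone G) (hle : ∀ j, G j ≤ m0)
    {v : ℕ → Ω → ℝ≥0∞} {f : Ω → ℝ≥0∞} (hf : Measurable f)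
    (hv : ∀ j, Measurable[G j] (v j))
    (hvf : ∀ j, ∀ φ : Ω → ℝ≥0∞, Measurable[G j] φ →
      ∫⁻ ω, φ ω * v j ω ∂μ ≤ ∫⁻ ω, φ ω * f ω ∂μ) :
    ∫⁻ ω, (⨆ j, v j ω) ^ 2 ∂μ ≤ 4 * ∫⁻ ω, f ω ^ 2 ∂μ := by
  have hv' := fun n => (hv n).mono (hle n) le_rfl
  have bound : ∀ N n : ℕ, ∫⁻ ω, (partialSups (fun j => min (v j ω) (N : ℝ≥0∞)) n) ^ 2 ∂μ ≤
      4 * ∫⁻ ω, f ω ^ 2 ∂μ := by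
    intro N n
    set M : Ω → ℝ≥0∞ := fun ω => partialSups (fun j => min (v j ω) (N : ℝ≥0∞)) n with hM
    have h1 : ∫⁻ ω, M ω ^ 2 ∂μ ≤ 2 * ∫⁻ ω, M ω * f ω ∂μ :=
      lintegral_partialSups_sq_le (v := fun j ω => min (v j ω) (N : ℝ≥0∞)) hG hle hf
        (fun j => Measurable.min (hv j) measurable_const)
        (fun j φ hφ => (lintegral_mono fun ω => by gcongr; exact min_le_left _ _).trans
          (hvf j φ hφ)) n
    have hMN : ∀ ω, M ω ≤ N := fun ω => partialSups_le _ _ _ fun j _ => min_le_right _ _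
    have hMm : Measurable M := measurable_partialSups (fun j => (hv' j).min measurable_const) n
    have hfin : ∫⁻ ω, M ω ^ 2 ∂μ ≠ ∞ := by
      refine ne_top_of_le_ne_top (b := (N : ℝ≥0∞) ^ 2) (by simp) ?_
      calc ∫⁻ ω, M ω ^ 2 ∂μ ≤ ∫⁻ _, (N : ℝ≥0∞) ^ 2 ∂μ :=
            lintegral_mono fun ω => by gcongr; exact hMN ω
        _ = _ := by simp
    have h2 : ∫⁻ ω, M ω ^ 2 ∂μ ≤ (∫⁻ ω, M ω ^ 2 ∂μ) / 2 + 2 * ∫⁻ ω, f ω ^ 2 ∂μ := by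
      refine h1.trans ?_
      rw [← lintegral_const_mul _ (hMm.fun_mul hf), div_eq_mul_inv,
        ← lintegral_mul_const _ (hMm.pow_const 2), ← lintegral_const_mul _ (hf.pow_const 2),
        ← lintegral_add_left ((hMm.pow_const 2).mul_const _)]
      exact lintegral_mono fun ω => by
        simpa [div_eq_mul_inv] using two_mul_le_half_sq_add (M ω) (f ω)
    by_cases hft : ∫⁻ ω, f ω ^ 2 ∂μ = ∞
    · simp [hft]
    change ∫⁻ ω, M ω ^ 2 ∂μ ≤ _
    lift (∫⁻ ω, M ω ^ 2 ∂μ) to NNReal using hfin with x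
    lift (∫⁻ ω, f ω ^ 2 ∂μ) to NNReal using hft with y
    have : ((x : ℝ≥0∞) / 2) = ((x / 2 : NNReal) : ℝ≥0∞) := by
      rw [ENNReal.coe_div two_ne_zero]; simp
    rw [this] at h2
    norm_cast at h2 ⊢
    rw [← NNReal.coe_le_coe] at h2 ⊢
    push_cast at h2 ⊢
    linarith
  have hsup : ∀ ω, (⨆ j, v j ω) ^ 2 =
      ⨆ n : ℕ, (partialSups (fun j => min (v j ω) (n : ℝ≥0∞)) n) ^ 2 := by
    intro ω
    have : (⨆ j, v j ω) = ⨆ n : ℕ, partialSups (fun j => min (v j ω) (n : ℝ≥0∞)) n := by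
      refine le_antisymm (iSup_le fun j => ?_) (iSup_le fun n => partialSups_le _ _ _
        fun j _ => (min_le_left _ _).trans (le_iSup (fun j => v j ω) j))
      refine le_of_forall_lt fun c hc => ?_
      obtain ⟨k, hk⟩ := ENNReal.exists_nat_gt hc.ne_top
      obtain ⟨N, hj, hk'⟩ : ∃ N, j ≤ N ∧ k ≤ N := ⟨max j k, le_max_left _ _, le_max_right _ _⟩
      have hcN : c < min (v j ω) (N : ℝ≥0∞) :=
        lt_min hc (hk.trans_le (by exact_mod_cast hk'))
      refine hcN.trans_le (le_iSup_of_le N ?_)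
      exact le_partialSups_of_le (fun j => min (v j ω) (N : ℝ≥0∞)) hj
    rw [this]
    exact (pow_left_mono 2).map_iSup_of_continuousAt (by fun_prop) (by simp)
  simp_rw [hsup]
  rw [lintegral_iSup]
  · exact iSup_le fun n => bound n n
  · intro n
    exact (measurable_partialSups (fun j => (hv' j).min measurable_const) n).pow_const 2
  · intro a b hab ω
    refine pow_le_pow_left' (partialSups_le _ _ _ fun j hj => ?_) 2
    refine le_trans (min_le_min le_rfl ?_) (le_partialSups_of_le
        (fun j => min (v j ω) (b : ℝ≥0∞)) (hj.trans hab))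
    exact_mod_cast hab

end Doob

theorem rpow_half_tsum_le_tsum_rpow_half {ι : Type*} (f : ι → ℝ≥0∞) :
    (∑' i, f i) ^ (1/2 : ℝ) ≤ ∑' i, f i ^ (1/2 : ℝ) := by
  classical
  have hs : ∀ s : Finset ι, (∑ i ∈ s, f i) ^ (1/2 : ℝ) ≤ ∑ i ∈ s, f i ^ (1/2 : ℝ) := by
    intro s
    induction s using Finset.induction_on with
    | empty => simp
    | insert a s ha ih =>
      rw [Finset.sum_insert ha, Finset.sum_insert ha]
      exact (ENNReal.rpow_add_le_add_rpow _ _ (by norm_num) (by norm_num)).trans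
        (add_le_add le_rfl ih)
  have hlim : Filter.Tendsto (fun s : Finset ι => (∑ i ∈ s, f i) ^ (1/2 : ℝ)) Filter.atTop
      (nhds ((∑' i, f i) ^ (1/2 : ℝ))) :=
    (ENNReal.continuous_rpow_const.tendsto _).comp ENNReal.summable.hasSum
  exact le_of_tendsto' hlim fun s => (hs s).trans (ENNReal.sum_le_tsum s)

theorem sq_rpow_half (x : ℝ≥0∞) : (x ^ 2) ^ (1/2 : ℝ) = x := by
  rw [← ENNReal.rpow_natCast, ← ENNReal.rpow_mul]; norm_num

theorem measurable_ennreal_tsum {Ω ι : Type*} [Countable ι] {m : MeasurableSpace Ω}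
    {f : ι → Ω → ℝ≥0∞} (hf : ∀ i, Measurable[m] (f i)) :
    Measurable[m] fun ω => ∑' i, f i ω :=
  Measurable.tsum hf

section Forward

variable {Ω : Type*} [m0 : MeasurableSpace Ω] {μ : Measure Ω} [IsProbabilityMeasure μ]

theorem lintegral_rpow_half_tsum_le_econdExp {G : ℕ → MeasurableSpace Ω} (hG : Monotone G)
    (hle : ∀ j, G j ≤ m0) {f : ℕ → Ω → ℝ≥0∞} (hf : ∀ j, Measurable (f j)) :
    ∫⁻ ω, (∑' j, f j ω) ^ (1/2 : ℝ) ∂μ ≤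
      3 * ∫⁻ ω, (∑' j, econdExp μ (G (j - 1)) (f j) ω) ^ (1/2 : ℝ) ∂μ := by
  have hG' : Monotone fun j => G (j - 1) := fun a b hab => hG (Nat.sub_le_sub_right hab 1)
  refine (lintegral_rpow_half_tsum_le hG' (fun j => hle _) hf
    (fun j => measurable_condLExp _ μ (f j)) fun j φ hφ =>
      (lintegral_mul_condLExp (hle _) (hf j) hφ).ge).trans (le_of_eq ?_)
  congr 1
  refine lintegral_congr_ae ?_
  filter_upwards [ae_all_iff.2 fun j => econdExp_ae_eq_condLExp (μ := μ) (hle (j - 1)) (hf j)]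
    with ω hω
  simp_rw [hω]

theorem lintegral_rpow_half_tsum_tsum_le_econdExp {G : ℕ → MeasurableSpace Ω} (hG : Monotone G)
    (hle : ∀ j, G j ≤ m0) {f : ℕ → ℕ → Ω → ℝ≥0∞} (hf : ∀ i j, Measurable (f i j)) :
    ∫⁻ ω, (∑' (i : ℕ) (j : ℕ), f i j ω) ^ (1/2 : ℝ) ∂μ ≤
      3 * ∑' i : ℕ, ∫⁻ ω, (∑' j, econdExp μ (G (j - 1)) (f i j) ω) ^ (1/2 : ℝ) ∂μ := by
  rw [← ENNReal.tsum_mul_left]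
  calc ∫⁻ ω, (∑' (i : ℕ) (j : ℕ), f i j ω) ^ (1/2 : ℝ) ∂μ
      ≤ ∫⁻ ω, ∑' i : ℕ, (∑' j : ℕ, f i j ω) ^ (1/2 : ℝ) ∂μ :=
        lintegral_mono fun ω => rpow_half_tsum_le_tsum_rpow_half _
    _ = ∑' i : ℕ, ∫⁻ ω, (∑' j : ℕ, f i j ω) ^ (1/2 : ℝ) ∂μ :=
        lintegral_tsum fun i => ((Measurable.tsum (hf i)).pow_const _).aemeasurable
    _ ≤ _ := ENNReal.tsum_le_tsum fun i => lintegral_rpow_half_tsum_le_econdExp hG hle (hf i)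

theorem IsF4Filtration.lintegral_rpow_half_tsum_le {𝓕 : ℕ → ℕ → MeasurableSpace Ω}
    (h : IsF4Filtration μ 𝓕) {f : ℕ → ℕ → Ω → ℝ≥0∞} (hf : ∀ i j, Measurable (f i j)) :
    ∫⁻ ω, (∑' (i : ℕ) (j : ℕ), f i j ω) ^ (1/2 : ℝ) ∂μ ≤
      9 * ∫⁻ ω, (∑' (i : ℕ) (j : ℕ), econdExp μ (𝓕 (i - 1) (j - 1)) (f i j) ω) ^ (1/2 : ℝ) ∂μ := by
  have hcol : Monotone fun j => colSup 𝓕 (j - 1) :=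
    fun a b hab => h.colSup_mono (Nat.sub_le_sub_right hab 1)
  have hrow : Monotone fun i => rowSup 𝓕 (i - 1) :=
    fun a b hab => h.rowSup_mono (Nat.sub_le_sub_right hab 1)
  have hc' : ∀ i j, Measurable (μ⁻[f i j|colSup 𝓕 (j - 1)]) := fun i j =>
    measurable_condLExp' _ _ _
  have hsum : ∀ (φ : Ω → ℝ≥0∞) (u : ℕ → Ω → ℝ≥0∞), Measurable φ → (∀ i, Measurable (u i)) →
      ∫⁻ ω, φ ω * ∑' i, u i ω ∂μ = ∑' i, ∫⁻ ω, φ ω * u i ω ∂μ := by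
    intro φ u hφ hu
    simp_rw [← ENNReal.tsum_mul_left]
    exact lintegral_tsum fun i => (hφ.fun_mul (hu i)).aemeasurable
  have step1 := _root_.lintegral_rpow_half_tsum_le (μ := μ) hcol (fun j => h.colSup_le _)
    (f := fun j ω => ∑' i, f i j ω) (g := fun j ω => ∑' i, μ⁻[f i j|colSup 𝓕 (j - 1)] ω)
    (fun j => Measurable.tsum fun i => hf i j)
    (fun j => measurable_ennreal_tsum fun i => measurable_condLExp _ _ _)
    (fun j φ hφ => by
      rw [hsum φ _ (hφ.mono (h.colSup_le _) le_rfl) (fun i => hf i j),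
        hsum φ _ (hφ.mono (h.colSup_le _) le_rfl) (fun i => hc' i j)]
      exact ENNReal.tsum_le_tsum fun i =>
        (lintegral_mul_condLExp (h.colSup_le _) (hf i j) hφ).ge)
  have step2 := _root_.lintegral_rpow_half_tsum_le (μ := μ) hrow (fun i => h.rowSup_le _)
    (f := fun i ω => ∑' j, μ⁻[f i j|colSup 𝓕 (j - 1)] ω)
    (g := fun i ω => ∑' j, μ⁻[f i j|𝓕 (i - 1) (j - 1)] ω)
    (fun i => Measurable.tsum fun j => hc' i j)
    (fun i => measurable_ennreal_tsum fun j => (measurable_condLExp _ _ _).mono (le_rowSup _ _ _) le_rfl)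
    (fun i φ hφ => by
      rw [hsum φ _ (hφ.mono (h.rowSup_le _) le_rfl) (fun j => hc' i j),
        hsum φ _ (hφ.mono (h.rowSup_le _) le_rfl) (fun j => measurable_condLExp' _ _ _)]
      exact ENNReal.tsum_le_tsum fun j =>
        lintegral_mul_le_of_setLIntegral_le (h.rowSup_le _) (hc' i j)
          (measurable_condLExp' _ _ _)
          (fun s hs => (h.setLIntegral_condLExp_colSup (i - 1) (j - 1) (hf i j) hs).le) hφ)
  have hE : ∫⁻ ω, (∑' (i : ℕ) (j : ℕ), econdExp μ (𝓕 (i - 1) (j - 1)) (f i j) ω) ^ (1/2 : ℝ) ∂μ =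
      ∫⁻ ω, (∑' (i : ℕ) (j : ℕ), μ⁻[f i j|𝓕 (i - 1) (j - 1)] ω) ^ (1/2 : ℝ) ∂μ := by
    refine lintegral_congr_ae ?_
    filter_upwards [ae_all_iff.2 fun i => ae_all_iff.2 fun j =>
      econdExp_ae_eq_condLExp (μ := μ) (h.le (i - 1) (j - 1)) (hf i j)] with ω hω
    simp_rw [hω]
  rw [hE]
  calc ∫⁻ ω, (∑' (i : ℕ) (j : ℕ), f i j ω) ^ (1/2 : ℝ) ∂μ
      = ∫⁻ ω, (∑' (j : ℕ) (i : ℕ), f i j ω) ^ (1/2 : ℝ) ∂μ :=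
        lintegral_congr fun ω => by rw [ENNReal.tsum_comm]
    _ ≤ 3 * ∫⁻ ω, (∑' (j : ℕ) (i : ℕ), μ⁻[f i j|colSup 𝓕 (j - 1)] ω) ^ (1/2 : ℝ) ∂μ := step1
    _ = 3 * ∫⁻ ω, (∑' (i : ℕ) (j : ℕ), μ⁻[f i j|colSup 𝓕 (j - 1)] ω) ^ (1/2 : ℝ) ∂μ := by
        simp_rw [ENNReal.tsum_comm (f := fun i j => μ⁻[f i j|colSup 𝓕 (j - 1)] _)]
    _ ≤ 3 * (3 * ∫⁻ ω, (∑' (i : ℕ) (j : ℕ), μ⁻[f i j|𝓕 (i - 1) (j - 1)] ω) ^ (1/2 : ℝ) ∂μ) := by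
        gcongr
    _ = _ := by rw [← mul_assoc]; norm_num

theorem enorm_add_four_sq_le (a b c d : ℝ) :
    (‖a + b + c + d‖₊ : ℝ≥0∞) ^ 2 ≤ 4 * ((‖a‖₊ : ℝ≥0∞) ^ 2 + (‖b‖₊ : ℝ≥0∞) ^ 2 +
      (‖c‖₊ : ℝ≥0∞) ^ 2 + (‖d‖₊ : ℝ≥0∞) ^ 2) := by
  norm_cast
  rw [← NNReal.coe_le_coe]
  push_cast
  simp only [Real.norm_eq_abs, sq_abs]
  nlinarith [sq_nonneg (a - b), sq_nonneg (a - c), sq_nonneg (a - d), sq_nonneg (b - c),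
    sq_nonneg (b - d), sq_nonneg (c - d)]

theorem rpow_half_add_four_le (a b c d : ℝ≥0∞) :
    (4 * (a + b + c + d)) ^ (1/2 : ℝ) ≤
      2 * (a ^ (1/2 : ℝ) + b ^ (1/2 : ℝ) + c ^ (1/2 : ℝ) + d ^ (1/2 : ℝ)) := by
  have h4 : (4 : ℝ≥0∞) ^ (1/2 : ℝ) = 2 := by
    rw [← sq_rpow_half 2]; norm_num
  have hadd : ∀ x y : ℝ≥0∞, (x + y) ^ (1/2 : ℝ) ≤ x ^ (1/2 : ℝ) + y ^ (1/2 : ℝ) := fun x y =>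
    ENNReal.rpow_add_le_add_rpow _ _ (by norm_num) (by norm_num)
  rw [ENNReal.mul_rpow_of_nonneg _ _ (by norm_num), h4]
  gcongr
  exact (hadd _ _).trans (add_le_add ((hadd _ _).trans (add_le_add (hadd _ _) le_rfl)) le_rfl)

theorem IsF4Filtration.lintegral_square_function_le_decompCost {𝓕 : ℕ → ℕ → MeasurableSpace Ω}
    (h : IsF4Filtration μ 𝓕) {X A B C D : ℕ → ℕ → Ω → ℝ}
    (hA : ∀ i j, Measurable (A i j)) (hB : ∀ i j, Measurable (B i j))
    (hC : ∀ i j, Measurable (C i j)) (hD : ∀ i j, Measurable (D i j))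
    (hX : ∀ i j ω, X i j ω = A i j ω + B i j ω + C i j ω + D i j ω) :
    ∫⁻ ω, (∑' (i : ℕ) (j : ℕ), (‖X i j ω‖₊ : ℝ≥0∞) ^ 2) ^ (1/2 : ℝ) ∂μ ≤
      18 * decompCost μ 𝓕 A B C D := by
  have hm : ∀ {Y : ℕ → ℕ → Ω → ℝ}, (∀ i j, Measurable (Y i j)) → ∀ i j,
      Measurable fun ω => (‖Y i j ω‖₊ : ℝ≥0∞) ^ 2 := fun hY i j =>
    (hY i j).enorm.pow_const 2
  have hS : ∀ {Y : ℕ → ℕ → Ω → ℝ}, (∀ i j, Measurable (Y i j)) →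
      Measurable fun ω => (∑' (i : ℕ) (j : ℕ), (‖Y i j ω‖₊ : ℝ≥0∞) ^ 2) ^ (1/2 : ℝ) := fun hY =>
    (Measurable.tsum fun i => Measurable.tsum fun j => hm hY i j).pow_const _
  have hpt : ∀ ω, (∑' (i : ℕ) (j : ℕ), (‖X i j ω‖₊ : ℝ≥0∞) ^ 2) ^ (1/2 : ℝ) ≤
      2 * ((∑' (i : ℕ) (j : ℕ), (‖A i j ω‖₊ : ℝ≥0∞) ^ 2) ^ (1/2 : ℝ) +
        (∑' (i : ℕ) (j : ℕ), (‖B i j ω‖₊ : ℝ≥0∞) ^ 2) ^ (1/2 : ℝ) +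
        (∑' (i : ℕ) (j : ℕ), (‖C i j ω‖₊ : ℝ≥0∞) ^ 2) ^ (1/2 : ℝ) +
        (∑' (i : ℕ) (j : ℕ), (‖D i j ω‖₊ : ℝ≥0∞) ^ 2) ^ (1/2 : ℝ)) := by
    intro ω
    refine le_trans ?_ (rpow_half_add_four_le _ _ _ _)
    gcongr
    simp_rw [← ENNReal.tsum_add, ← ENNReal.tsum_mul_left]
    refine ENNReal.tsum_le_tsum fun i => ENNReal.tsum_le_tsum fun j => ?_
    rw [hX]
    exact enorm_add_four_sq_le _ _ _ _
  have h1 : ∫⁻ ω, (∑' (i : ℕ) (j : ℕ), (‖A i j ω‖₊ : ℝ≥0∞) ^ 2) ^ (1/2 : ℝ) ∂μ ≤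
      9 * ∑' (i : ℕ) (j : ℕ), ∫⁻ ω, (‖A i j ω‖₊ : ℝ≥0∞) ∂μ := by
    calc _ ≤ ∫⁻ ω, ∑' (i : ℕ) (j : ℕ), (‖A i j ω‖₊ : ℝ≥0∞) ∂μ := by
          refine lintegral_mono fun ω => ?_
          refine (rpow_half_tsum_le_tsum_rpow_half _).trans (ENNReal.tsum_le_tsum fun i => ?_)
          refine (rpow_half_tsum_le_tsum_rpow_half _).trans (ENNReal.tsum_le_tsum fun j => ?_)
          exact (sq_rpow_half _).le
      _ = ∑' (i : ℕ) (j : ℕ), ∫⁻ ω, (‖A i j ω‖₊ : ℝ≥0∞) ∂μ := by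
          refine (lintegral_tsum fun i =>
            (measurable_ennreal_tsum fun j => (hA i j).enorm).aemeasurable).trans ?_
          exact tsum_congr fun i => lintegral_tsum fun j => (hA i j).enorm.aemeasurable
      _ ≤ _ := le_mul_of_one_le_left zero_le (by norm_num)
  have h2 := h.lintegral_rpow_half_tsum_le (hm hB)
  have h3 := (lintegral_rpow_half_tsum_tsum_le_econdExp (μ := μ) h.colSup_mono h.colSup_le
    (hm hC)).trans (mul_le_mul_left (by norm_num : (3 : ℝ≥0∞) ≤ 9) _)
  have h4 := (lintegral_rpow_half_tsum_tsum_le_econdExp (μ := μ) h.rowSup_mono h.rowSup_le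
    fun j i => hm hD i j).trans (mul_le_mul_left (by norm_num : (3 : ℝ≥0∞) ≤ 9) _)
  have h4' : ∫⁻ ω, (∑' (i : ℕ) (j : ℕ), (‖D i j ω‖₊ : ℝ≥0∞) ^ 2) ^ (1/2 : ℝ) ∂μ =
      ∫⁻ ω, (∑' (j : ℕ) (i : ℕ), (‖D i j ω‖₊ : ℝ≥0∞) ^ 2) ^ (1/2 : ℝ) ∂μ :=
    lintegral_congr fun ω => by rw [ENNReal.tsum_comm]
  rw [← h4'] at h4
  refine (lintegral_mono hpt).trans ?_
  rw [lintegral_const_mul _ ((((hS hA).fun_add (hS hB)).fun_add (hS hC)).fun_add (hS hD)),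
    lintegral_add_right _ (hS hD), lintegral_add_right _ (hS hC), lintegral_add_right _ (hS hB)]
  refine (mul_le_mul_right (add_le_add (add_le_add (add_le_add h1 h2) h3) h4) 2).trans (le_of_eq ?_)
  rw [decompCost]
  ring

end Forward

theorem measurable_ennreal_iSup {Ω ι : Type*} [Countable ι] {m : MeasurableSpace Ω}
    {f : ι → Ω → ℝ≥0∞} (hf : ∀ i, Measurable[m] (f i)) :
    Measurable[m] fun ω => ⨆ i, f i ω :=
  Measurable.iSup hf

section SquareIntegrable

variable {Ω : Type*} {m : MeasurableSpace Ω} [m0 : MeasurableSpace Ω] {μ : Measure Ω}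
  [IsProbabilityMeasure μ]

theorem lintegral_enorm_sq_eq_ofReal {g : Ω → ℝ} (hg : MemLp g 2 μ) :
    ∫⁻ ω, ‖g ω‖ₑ ^ 2 ∂μ = ENNReal.ofReal (∫ ω, g ω ^ 2 ∂μ) := by
  rw [ofReal_integral_eq_lintegral_ofReal hg.integrable_sq
    (Filter.Eventually.of_forall fun ω => sq_nonneg _)]
  refine lintegral_congr fun ω => ?_
  rw [← sq_abs, ENNReal.ofReal_pow (abs_nonneg _), Real.enorm_eq_ofReal_abs]

theorem lintegral_enorm_sub_condExp_sq_add (hm : m ≤ m0) {g : Ω → ℝ}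
    (hg : MemLp g 2 μ) :
    ∫⁻ ω, ‖g ω - (μ[g|m]) ω‖ₑ ^ 2 ∂μ + ∫⁻ ω, ‖(μ[g|m]) ω‖ₑ ^ 2 ∂μ = ∫⁻ ω, ‖g ω‖ₑ ^ 2 ∂μ := by
  have hE : MemLp (μ[g|m]) 2 μ := hg.condExp one_le_two
  have hvar := ProbabilityTheory.condVar_ae_eq_condExp_sq_sub_sq_condExp hm hg
  have h_int : ∫ ω, (g ω - (μ[g|m]) ω) ^ 2 ∂μ = ∫ ω, g ω ^ 2 ∂μ - ∫ ω, (μ[g|m]) ω ^ 2 ∂μ := by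
    have h1 : ∫ ω, (g ω - (μ[g|m]) ω) ^ 2 ∂μ =
        ∫ ω, (ProbabilityTheory.condVar m g μ) ω ∂μ :=
      (integral_condExp hm (f := (g - μ[g|m]) ^ 2)).symm
    rw [h1, integral_congr_ae hvar]
    have h2 : ∫ ω, (μ[g ^ 2|m]) ω ∂μ = ∫ ω, g ω ^ 2 ∂μ := integral_condExp hm
    rw [← h2]
    exact integral_sub integrable_condExp hE.integrable_sq
  have h1 := lintegral_enorm_sq_eq_ofReal (hg.sub hE)
  simp only [Pi.sub_apply] at h1
  rw [h1, lintegral_enorm_sq_eq_ofReal hE, lintegral_enorm_sq_eq_ofReal hg, h_int,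
    ← ENNReal.ofReal_add _ (integral_nonneg fun ω => sq_nonneg _), sub_add_cancel]
  rw [← h_int]
  exact integral_nonneg fun ω => sq_nonneg _

theorem tsum_lintegral_enorm_condExp_sub_sq_le {G : ℕ → MeasurableSpace Ω} (hG : Monotone G)
    (hle : ∀ j, G j ≤ m0) {f : Ω → ℝ} (hf : MemLp f 2 μ) :
    ∑' j, ∫⁻ ω, ‖(μ[f|G j]) ω - (μ[f|G (j - 1)]) ω‖ₑ ^ 2 ∂μ ≤ ∫⁻ ω, ‖f ω‖ₑ ^ 2 ∂μ := by
  have hpartial : ∀ n, ∑ j ∈ Finset.range (n + 1),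
      ∫⁻ ω, ‖(μ[f|G j]) ω - (μ[f|G (j - 1)]) ω‖ₑ ^ 2 ∂μ ≤ ∫⁻ ω, ‖(μ[f|G n]) ω‖ₑ ^ 2 ∂μ := by
    intro n
    induction n with
    | zero => simp
    | succ n ih =>
      rw [Finset.sum_range_succ]
      refine (add_le_add ih le_rfl).trans (le_of_eq ?_)
      rw [← lintegral_enorm_sub_condExp_sq_add (hle n) (hf.condExp one_le_two (m := G (n + 1))),
        add_comm]
      have htower : μ[μ[f|G (n + 1)]|G n] =ᵐ[μ] μ[f|G n] :=
        condExp_condExp_of_le (hG n.le_succ) (hle _)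
      congr 1 <;>
      · refine lintegral_congr_ae ?_
        filter_upwards [htower] with ω hω
        rw [hω]
        try rfl
  rw [ENNReal.tsum_eq_iSup_nat]
  refine iSup_le fun n => ?_
  refine (Finset.sum_le_sum_of_subset (Finset.range_mono n.le_succ)).trans
    ((hpartial n).trans ?_)
  rw [← lintegral_enorm_sub_condExp_sq_add (hle n) hf]
  exact le_add_self

theorem setLIntegral_enorm_condExp_le {f : Ω → ℝ}
    (hf : Integrable f μ) {s : Set Ω} (hs : MeasurableSet[m] s) :
    ∫⁻ ω in s, ‖(μ[f|m]) ω‖ₑ ∂μ ≤ ∫⁻ ω in s, ‖f ω‖ₑ ∂μ := by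
  rw [← ofReal_integral_norm_eq_lintegral_enorm integrable_condExp.integrableOn,
    ← ofReal_integral_norm_eq_lintegral_enorm hf.integrableOn]
  exact ENNReal.ofReal_le_ofReal (setIntegral_abs_condExp_le hs f)

theorem lintegral_iSup_enorm_condExp_sq_le {G : ℕ → MeasurableSpace Ω} (hG : Monotone G)
    (hle : ∀ j, G j ≤ m0) {f : Ω → ℝ} (hfm : Measurable f) (hf : Integrable f μ) :
    ∫⁻ ω, (⨆ j, ‖(μ[f|G j]) ω‖ₑ) ^ 2 ∂μ ≤ 4 * ∫⁻ ω, ‖f ω‖ₑ ^ 2 ∂μ :=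
  have hm : ∀ j, Measurable[G j] fun ω => ‖(μ[f|G j]) ω‖ₑ := fun _ =>
    stronglyMeasurable_condExp.enorm
  lintegral_iSup_sq_le hG hle hfm.enorm hm fun j φ hφ =>
    lintegral_mul_le_of_setLIntegral_le (hle j) ((hm j).mono (hle j) le_rfl) hfm.enorm
      (fun _ hs => setLIntegral_enorm_condExp_le hf hs) hφ

variable {𝓕 : ℕ → ℕ → MeasurableSpace Ω}

/-- The strong maximal inequality in `L²`. -/
theorem IsF4Filtration.lintegral_iSup_iSup_enorm_condExp_sq_le (h : IsF4Filtration μ 𝓕)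
    {f : Ω → ℝ} (hfm : Measurable f) (hf : Integrable f μ) :
    ∫⁻ ω, (⨆ i, ⨆ j, ‖(μ[f|𝓕 i j]) ω‖ₑ) ^ 2 ∂μ ≤ 16 * ∫⁻ ω, ‖f ω‖ₑ ^ 2 ∂μ := by
  set g : Ω → ℝ≥0∞ := fun ω => ⨆ j, ‖(μ[f|colSup 𝓕 j]) ω‖ₑ with hg
  have hcm : ∀ j, Measurable (μ[f|colSup 𝓕 j]) := fun j =>
    (stronglyMeasurable_condExp.mono (h.colSup_le j)).measurable
  have hgm : Measurable g := Measurable.iSup fun j => (hcm j).enorm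
  have hm : ∀ i j, Measurable[𝓕 i j] fun ω => ‖(μ[f|𝓕 i j]) ω‖ₑ := fun i j =>
    stronglyMeasurable_condExp.enorm
  have hm' : ∀ i j, Measurable[rowSup 𝓕 i] fun ω => ‖(μ[f|𝓕 i j]) ω‖ₑ := fun i j =>
    (hm i j).mono (le_rowSup 𝓕 i j) le_rfl
  have hle : ∀ i, ∀ᵐ ω ∂μ, ⨆ j, ‖(μ[f|𝓕 i j]) ω‖ₑ ≤ μ⁻[g|rowSup 𝓕 i] ω := by
    intro i
    have : ∀ j, (fun ω => ‖(μ[f|𝓕 i j]) ω‖ₑ) ≤ᵐ[μ] μ⁻[g|rowSup 𝓕 i] := by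
      intro j
      refine ae_le_of_setLIntegral_le_sub (h.rowSup_le i) (hm' i j) (measurable_condLExp _ _ _)
        fun s hs => ?_
      rw [setLIntegral_condLExp (h.rowSup_le i) μ g hs]
      calc ∫⁻ ω in s, ‖(μ[f|𝓕 i j]) ω‖ₑ ∂μ
          = ∫⁻ ω in s, ‖(μ[μ[f|colSup 𝓕 j]|rowSup 𝓕 i]) ω‖ₑ ∂μ := by
            refine lintegral_congr_ae (ae_restrict_of_ae ?_)
            filter_upwards [h.condExp_colSup_rowSup i j hf] with ω hω
            rw [hω]
        _ ≤ ∫⁻ ω in s, ‖(μ[f|colSup 𝓕 j]) ω‖ₑ ∂μ :=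
            setLIntegral_enorm_condExp_le integrable_condExp hs
        _ ≤ ∫⁻ ω in s, g ω ∂μ :=
            lintegral_mono fun ω => le_iSup (fun j => ‖(μ[f|colSup 𝓕 j]) ω‖ₑ) j
    filter_upwards [ae_all_iff.2 this] with ω hω using iSup_le hω
  have h1 : ∫⁻ ω, (⨆ i, ⨆ j, ‖(μ[f|𝓕 i j]) ω‖ₑ) ^ 2 ∂μ ≤ 4 * ∫⁻ ω, g ω ^ 2 ∂μ := by
    refine lintegral_iSup_sq_le (G := rowSup 𝓕) h.rowSup_mono h.rowSup_le hgm
      (v := fun i ω => ⨆ j, ‖(μ[f|𝓕 i j]) ω‖ₑ) (fun i => ?_) fun i φ hφ => ?_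
    · exact measurable_ennreal_iSup (hm' i)
    · rw [← lintegral_mul_condLExp (h.rowSup_le i) hgm hφ]
      refine lintegral_mono_ae ?_
      filter_upwards [hle i] with ω hω
      gcongr
  refine h1.trans ?_
  have h2 := lintegral_iSup_enorm_condExp_sq_le h.colSup_mono h.colSup_le hfm hf
  calc 4 * ∫⁻ ω, g ω ^ 2 ∂μ ≤ 4 * (4 * ∫⁻ ω, ‖f ω‖ₑ ^ 2 ∂μ) := by gcongr
    _ = _ := by rw [← mul_assoc]; norm_num

theorem IsF4Filtration.condExp_sub_ae_eq (h : IsF4Filtration μ 𝓕) {f : Ω → ℝ}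
    (hf : Integrable f μ) (i k j : ℕ) :
    μ[fun ω => (μ[f|rowSup 𝓕 i]) ω - (μ[f|rowSup 𝓕 k]) ω|colSup 𝓕 j] =ᵐ[μ]
      fun ω => (μ[f|𝓕 i j]) ω - (μ[f|𝓕 k j]) ω :=
  (condExp_sub integrable_condExp integrable_condExp _).trans
    ((h.condExp_rowSup_colSup i j hf).sub (h.condExp_rowSup_colSup k j hf))

theorem IsF4Filtration.tsum_lintegral_iSup_enorm_condExp_sub_sq_le (h : IsF4Filtration μ 𝓕)
    {f : Ω → ℝ} (hf : MemLp f 2 μ) :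
    ∑' i, ∫⁻ ω, (⨆ j, ‖(μ[f|𝓕 i j]) ω - (μ[f|𝓕 (i - 1) j]) ω‖ₑ) ^ 2 ∂μ ≤
      4 * ∫⁻ ω, ‖f ω‖ₑ ^ 2 ∂μ := by
  have hfi : Integrable f μ := hf.integrable one_le_two
  have hcm : ∀ i, Measurable (μ[f|rowSup 𝓕 i]) := fun i =>
    (stronglyMeasurable_condExp.mono (h.rowSup_le i)).measurable
  refine le_trans ?_ (mul_le_mul_right
    (tsum_lintegral_enorm_condExp_sub_sq_le h.rowSup_mono h.rowSup_le hf) 4)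
  rw [← ENNReal.tsum_mul_left]
  refine ENNReal.tsum_le_tsum fun i => ?_
  refine le_trans (le_of_eq ?_) (lintegral_iSup_enorm_condExp_sq_le h.colSup_mono h.colSup_le
    ((hcm i).fun_sub (hcm (i - 1))) (integrable_condExp.sub integrable_condExp))
  refine lintegral_congr_ae ?_
  filter_upwards [ae_all_iff.2 fun j => h.condExp_sub_ae_eq hfi i (i - 1) j] with ω hω
  simp_rw [hω]

theorem IsF4Filtration.tsum_tsum_lintegral_enorm_sq_le (h : IsF4Filtration μ 𝓕)
    {f : Ω → ℝ} (hf : MemLp f 2 μ) :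
    ∑' (i : ℕ) (j : ℕ), ∫⁻ ω, ‖((μ[f|𝓕 i j]) ω - (μ[f|𝓕 (i - 1) j]) ω) -
      ((μ[f|𝓕 i (j - 1)]) ω - (μ[f|𝓕 (i - 1) (j - 1)]) ω)‖ₑ ^ 2 ∂μ ≤ ∫⁻ ω, ‖f ω‖ₑ ^ 2 ∂μ := by
  have hfi : Integrable f μ := hf.integrable one_le_two
  refine le_trans (ENNReal.tsum_le_tsum fun i => ?_)
    (tsum_lintegral_enorm_condExp_sub_sq_le h.rowSup_mono h.rowSup_le hf)
  refine le_trans (ENNReal.tsum_le_tsum fun j => le_of_eq ?_)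
    (tsum_lintegral_enorm_condExp_sub_sq_le h.colSup_mono h.colSup_le
      ((hf.condExp one_le_two (m := rowSup 𝓕 i)).sub
        (hf.condExp one_le_two (m := rowSup 𝓕 (i - 1)))))
  refine lintegral_congr_ae ?_
  filter_upwards [h.condExp_sub_ae_eq hfi i (i - 1) j,
    h.condExp_sub_ae_eq hfi i (i - 1) (j - 1)] with ω h1 h2
  rw [h1, h2]

theorem measure_exists_lt_le {ι : Type*} {u : ι → Ω → ℝ} (n : ℕ) (hn : n ≠ 0)
    (hu : Measurable fun ω => (⨆ i, ‖u i ω‖ₑ : ℝ≥0∞)) :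
    μ {ω | ∃ i, (n : ℝ)⁻¹ < u i ω} ≤ (n : ℝ≥0∞) ^ 2 * ∫⁻ ω, (⨆ i, ‖u i ω‖ₑ) ^ 2 ∂μ := by
  have hn0 : (n : ℝ≥0∞) ≠ 0 := by exact_mod_cast hn
  have hnt : (n : ℝ≥0∞) ≠ ∞ := ENNReal.natCast_ne_top n
  have h1 := mul_meas_ge_le_lintegral (μ := μ) (hu.pow_const 2) (((n : ℝ≥0∞)⁻¹) ^ 2)
  rw [← lintegral_const_mul _ (hu.pow_const 2)]
  calc μ {ω | ∃ i, (n : ℝ)⁻¹ < u i ω} ≤ μ {ω | ((n : ℝ≥0∞)⁻¹) ^ 2 ≤ (⨆ i, ‖u i ω‖ₑ) ^ 2} := by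
        refine measure_mono fun ω ⟨i, hi⟩ => ?_
        have hle : (n : ℝ≥0∞)⁻¹ ≤ ‖u i ω‖ₑ := ?_
        · exact pow_le_pow_left' (hle.trans (le_iSup (fun i => ‖u i ω‖ₑ) i)) 2
        rw [Real.enorm_eq_ofReal_abs]
        refine le_trans ?_ (ENNReal.ofReal_le_ofReal (hi.le.trans (le_abs_self _)))
        rw [ENNReal.ofReal_inv_of_pos (by positivity), ENNReal.ofReal_natCast]
    _ = (n : ℝ≥0∞) ^ 2 * (((n : ℝ≥0∞)⁻¹) ^ 2 *
          μ {ω | ((n : ℝ≥0∞)⁻¹) ^ 2 ≤ (⨆ i, ‖u i ω‖ₑ) ^ 2}) := by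
        rw [← mul_assoc, ← mul_pow, ENNReal.mul_inv_cancel hn0 hnt, one_pow, one_mul]
    _ ≤ _ := by
        rw [lintegral_const_mul _ (hu.pow_const 2)]
        gcongr

end SquareIntegrable

theorem tsum_zpow_two_indicator_lt_le (x : ℝ≥0∞) :
    ∑' k : ℤ, (if (2 : ℝ≥0∞) ^ k < x then (2 : ℝ≥0∞) ^ k else 0) ≤ 2 * x := by
  by_cases hx : x = ∞
  · simp [hx]
  lift x to NNReal using hx
  let s : ℤ → Set ℝ := fun k =>
    if (2 : ℝ≥0∞) ^ k < x then Set.Ioc ((2 : ℝ) ^ k) ((2 : ℝ) ^ (k + 1)) else ∅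
  have hsub : ∀ k, s k ⊆ Set.Ioc ((2 : ℝ) ^ k) ((2 : ℝ) ^ (k + 1)) := fun k => by
    simp only [s]; split_ifs <;> simp
  have hdisj : Pairwise (Function.onFun Disjoint s) := fun k l hkl =>
    ((zpow_right_mono₀ (one_le_two (α := ℝ))).pairwise_disjoint_on_Ioc_succ hkl).mono (hsub k) (hsub l)
  have hmeas : ∀ k, MeasurableSet (s k) := fun k => by
    simp only [s]; split_ifs <;> simp
  have hcoe : ∀ k : ℤ, (2 : ℝ≥0∞) ^ k = ENNReal.ofReal ((2 : ℝ) ^ k) := fun k => by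
    have h2 : (2 : ℝ) ^ k = (((2 : NNReal) ^ k : NNReal) : ℝ) := by push_cast; rfl
    rw [h2, ENNReal.ofReal_coe_nnreal, ENNReal.coe_zpow two_ne_zero]; rfl
  calc ∑' k : ℤ, (if (2 : ℝ≥0∞) ^ k < x then (2 : ℝ≥0∞) ^ k else 0)
      = ∑' k : ℤ, volume (s k) := by
        congr 1; funext k
        simp only [s]
        split_ifs
        · rw [Real.volume_Ioc, hcoe, zpow_add_one₀ two_ne_zero]
          congr 1; ring
        · simp
    _ ≤ volume (⋃ k, s k) :=
        tsum_meas_le_meas_iUnion_of_disjoint volume hmeas hdisj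
    _ ≤ volume (Set.Ioc (0 : ℝ) (2 * x)) := by
        refine measure_mono (Set.iUnion_subset fun k => ?_)
        simp only [s]
        split_ifs with hk
        · intro y hy
          have h2 : (2 : ℝ) ^ k < x := by
            rw [hcoe, ← ENNReal.ofReal_coe_nnreal] at hk
            exact (ENNReal.ofReal_lt_ofReal_iff_of_nonneg (by positivity)).1 hk
          refine ⟨lt_of_lt_of_le (by positivity) hy.1.le, hy.2.trans ?_⟩
          rw [zpow_add_one₀ two_ne_zero]
          linarith
        · simp
    _ = 2 * x := by
        rw [Real.volume_Ioc, sub_zero, ENNReal.ofReal_mul (by norm_num)]; simp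

section Level

variable {Ω : Type*} [m0 : MeasurableSpace Ω] {μ : Measure Ω}

theorem lintegral_rpow_half_tsum_le_of_le_tsum_indicator {S : Type*} [Countable S]
    {U : ℤ → Set Ω} (hU : ∀ k, MeasurableSet (U k)) {r : ℤ → S → Ω → ℝ≥0∞}
    (hr : ∀ k s, Measurable (r k s)) {e : S → Ω → ℝ≥0∞}
    (he : ∀ s, ∀ᵐ ω ∂μ, e s ω ≤ ∑' k, (U k).indicator (r k s) ω) :
    ∫⁻ ω, (∑' s, e s ω) ^ (1/2 : ℝ) ∂μ ≤
      ∑' k : ℤ, ((2 : ℝ≥0∞) ^ k * μ (U k) + ((2 : ℝ≥0∞) ^ k)⁻¹ * ∑' s, ∫⁻ ω, r k s ω ∂μ) := by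
  have hpt : ∀ᵐ ω ∂μ, (∑' s, e s ω) ^ (1/2 : ℝ) ≤
      ∑' k : ℤ, ((U k).indicator (fun _ => (2 : ℝ≥0∞) ^ k) ω +
        ((2 : ℝ≥0∞) ^ k)⁻¹ * ∑' s, r k s ω) := by
    filter_upwards [ae_all_iff.2 he] with ω hω
    calc (∑' s, e s ω) ^ (1/2 : ℝ)
        ≤ (∑' s, ∑' k, (U k).indicator (r k s) ω) ^ (1/2 : ℝ) :=
          ENNReal.rpow_le_rpow (ENNReal.tsum_le_tsum hω) (by norm_num)
      _ = (∑' k, ∑' s, (U k).indicator (r k s) ω) ^ (1/2 : ℝ) := by rw [ENNReal.tsum_comm]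
      _ ≤ ∑' k, (∑' s, (U k).indicator (r k s) ω) ^ (1/2 : ℝ) :=
          rpow_half_tsum_le_tsum_rpow_half _
      _ ≤ _ := by
          refine ENNReal.tsum_le_tsum fun k => ?_
          by_cases hk : ω ∈ U k
          · simp only [Set.indicator_of_mem hk]
            have h2 : (2 : ℝ≥0∞) ^ k * ((2 : ℝ≥0∞) ^ k)⁻¹ = 1 :=
              ENNReal.mul_inv_cancel (ENNReal.zpow_pos (by simp) (by simp) k).ne'
                (ENNReal.zpow_ne_top (by simp) (by simp) k)
            calc (∑' s, r k s ω) ^ (1/2 : ℝ)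
                = ((2 : ℝ≥0∞) ^ k * (((2 : ℝ≥0∞) ^ k)⁻¹ * ∑' s, r k s ω)) ^ (1/2 : ℝ) := by
                  rw [← mul_assoc, h2, one_mul]
              _ ≤ _ := rpow_half_mul_le _ _
          · simp [Set.indicator_of_notMem hk]
  refine (lintegral_mono_ae hpt).trans (le_of_eq ?_)
  have hm1 : ∀ k, Measurable ((U k).indicator fun _ => (2 : ℝ≥0∞) ^ k) := fun k =>
    measurable_const.indicator (hU k)
  have hm2 : ∀ k : ℤ, Measurable fun ω => ∑' s, r k s ω := fun k =>
    measurable_ennreal_tsum (hr k)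
  rw [lintegral_tsum fun k => ((hm1 k).fun_add ((hm2 k).const_mul _)).aemeasurable]
  refine tsum_congr fun k => ?_
  rw [lintegral_add_left (hm1 k), lintegral_indicator_const (hU k), lintegral_const_mul _ (hm2 k),
    lintegral_tsum fun s => (hr k s).aemeasurable]

theorem lintegral_rpow_half_tsum_econdExp_le_of_le_tsum_indicator [IsFiniteMeasure μ]
    {S : Type*} [Countable S] {m : S → MeasurableSpace Ω} (hm : ∀ s, m s ≤ m0)
    {U : ℤ → Set Ω} (hU : ∀ k, MeasurableSet (U k)) {Q : ℤ → S → Set Ω}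
    (hQ : ∀ k s, MeasurableSet[m s] (Q k s)) (hQU : ∀ k s, Q k s ⊆ U k)
    {p : ℤ → S → Ω → ℝ≥0∞} (hp : ∀ k s, Measurable (p k s)) {Y : S → Ω → ℝ≥0∞}
    (hY : ∀ s, Measurable (Y s)) (hYp : ∀ s ω, Y s ω ≤ ∑' k, (Q k s).indicator (p k s) ω) :
    ∫⁻ ω, (∑' s, econdExp μ (m s) (Y s) ω) ^ (1/2 : ℝ) ∂μ ≤
      ∑' k : ℤ, ((2 : ℝ≥0∞) ^ k * μ (U k) + ((2 : ℝ≥0∞) ^ k)⁻¹ * ∑' s, ∫⁻ ω, p k s ω ∂μ) := by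
  have hcm : ∀ k s, Measurable[m s] (μ⁻[p k s|m s]) := fun k s => measurable_condLExp _ _ _
  have key : ∀ s, μ⁻[Y s|m s] ≤ᵐ[μ] fun ω => ∑' k, (Q k s).indicator (μ⁻[p k s|m s]) ω := by
    intro s
    refine ae_le_of_setLIntegral_le_sub (hm s) (measurable_condLExp _ _ _)
      (measurable_ennreal_tsum fun k => (hcm k s).indicator (hQ k s)) fun t ht => ?_
    rw [setLIntegral_condLExp (hm s) μ _ ht, lintegral_tsum fun k =>
      (((hcm k s).mono (hm s) le_rfl).indicator (hm s _ (hQ k s))).aemeasurable]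
    calc ∫⁻ ω in t, Y s ω ∂μ ≤ ∫⁻ ω in t, ∑' k, (Q k s).indicator (p k s) ω ∂μ :=
          lintegral_mono (hYp s)
      _ = ∑' k, ∫⁻ ω in t, (Q k s).indicator (p k s) ω ∂μ :=
          lintegral_tsum fun k => ((hp k s).indicator (hm s _ (hQ k s))).aemeasurable
      _ ≤ _ := by
          refine ENNReal.tsum_le_tsum fun k => le_of_eq ?_
          have hQ0 := hm s _ (hQ k s)
          rw [lintegral_indicator hQ0, lintegral_indicator hQ0, Measure.restrict_restrict hQ0,
            setLIntegral_condLExp (hm s) μ _ ((hQ k s).inter ht)]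
  refine (lintegral_rpow_half_tsum_le_of_le_tsum_indicator hU
    (r := fun k s => μ⁻[p k s|m s]) (fun k s => (hcm k s).mono (hm s) le_rfl) fun s => ?_).trans
    (le_of_eq ?_)
  · filter_upwards [econdExp_ae_eq_condLExp (hm s) (hY s), key s] with ω h1 h2
    rw [h1]
    refine h2.trans (ENNReal.tsum_le_tsum fun k => ?_)
    exact Set.indicator_le_indicator_of_subset (hQU k s) (fun _ => zero_le) ω
  · simp_rw [lintegral_condLExp (hm _)]

end Level

/-- The conditional probabilities of the set `L` along a two-parameter filtration. -/
noncomputable def levelProb {Ω : Type*} [MeasurableSpace Ω] (μ : Measure Ω)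
    (𝓕 : ℕ → ℕ → MeasurableSpace Ω) (L : Set Ω) (i j : ℕ) : Ω → ℝ :=
  μ[L.indicator (1 : Ω → ℝ)|𝓕 i j]

section LevelProb

variable {Ω : Type*} [m0 : MeasurableSpace Ω] {μ : Measure Ω} [IsProbabilityMeasure μ]
  {𝓕 : ℕ → ℕ → MeasurableSpace Ω} {L : Set Ω}

theorem measurable_levelProb (i j : ℕ) : Measurable[𝓕 i j] (levelProb μ 𝓕 L i j) :=
  stronglyMeasurable_condExp.measurable

theorem memLp_indicator_one (hL : MeasurableSet L) : MemLp (L.indicator (1 : Ω → ℝ)) 2 μ :=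
  (memLp_const (1 : ℝ)).indicator hL

theorem lintegral_enorm_indicator_one_sq (hL : MeasurableSet L) :
    ∫⁻ ω, ‖L.indicator (1 : Ω → ℝ) ω‖ₑ ^ 2 ∂μ = μ L := by
  rw [← lintegral_indicator_one hL]
  refine lintegral_congr fun ω => ?_
  by_cases hω : ω ∈ L <;> simp [hω]

theorem IsF4Filtration.measurable_levelProb (h : IsF4Filtration μ 𝓕) (i j : ℕ) :
    Measurable (levelProb μ 𝓕 L i j) :=
  (_root_.measurable_levelProb i j).mono (h.le i j) le_rfl

theorem IsF4Filtration.measure_exists_lt_levelProb_le (h : IsF4Filtration μ 𝓕)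
    (hL : MeasurableSet L) (n : ℕ) (hn : n ≠ 0) :
    μ {ω | ∃ i j, (n : ℝ)⁻¹ < levelProb μ 𝓕 L i j ω} ≤ (n : ℝ≥0∞) ^ 2 * (16 * μ L) := by
  have hu : Measurable fun ω => (⨆ p : ℕ × ℕ, ‖levelProb μ 𝓕 L p.1 p.2 ω‖ₑ : ℝ≥0∞) :=
    measurable_ennreal_iSup fun p => (h.measurable_levelProb p.1 p.2).enorm
  have h1 := measure_exists_lt_le n hn hu (μ := μ)
  simp only [Prod.exists, iSup_prod] at h1
  refine h1.trans (mul_le_mul_right ?_ _)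
  rw [← lintegral_enorm_indicator_one_sq hL (μ := μ)]
  exact h.lintegral_iSup_iSup_enorm_condExp_sq_le (measurable_one.indicator hL)
    ((memLp_indicator_one hL).integrable one_le_two)

theorem IsF4Filtration.tsum_measure_exists_lt_levelProb_sub_le (h : IsF4Filtration μ 𝓕)
    (hL : MeasurableSet L) (n : ℕ) (hn : n ≠ 0) :
    ∑' i, μ {ω | ∃ j, (n : ℝ)⁻¹ < levelProb μ 𝓕 L i j ω - levelProb μ 𝓕 L (i - 1) j ω} ≤
      (n : ℝ≥0∞) ^ 2 * (4 * μ L) := by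
  have h1 := h.tsum_lintegral_iSup_enorm_condExp_sub_sq_le (memLp_indicator_one hL)
  rw [lintegral_enorm_indicator_one_sq hL] at h1
  refine le_trans (ENNReal.tsum_le_tsum fun i => measure_exists_lt_le n hn ?_)
    (ENNReal.tsum_mul_left.trans_le (mul_le_mul_right h1 _))
  exact measurable_ennreal_iSup fun j =>
    ((h.measurable_levelProb i j).fun_sub (h.measurable_levelProb (i - 1) j)).enorm

theorem IsF4Filtration.tsum_tsum_measure_lt_levelProb_le (h : IsF4Filtration μ 𝓕)
    (hL : MeasurableSet L) (n : ℕ) (hn : n ≠ 0) :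
    ∑' i, ∑' j, μ {ω | (n : ℝ)⁻¹ < (levelProb μ 𝓕 L i j ω - levelProb μ 𝓕 L (i - 1) j ω) -
      (levelProb μ 𝓕 L i (j - 1) ω - levelProb μ 𝓕 L (i - 1) (j - 1) ω)} ≤
      (n : ℝ≥0∞) ^ 2 * μ L := by
  have h1 := h.tsum_tsum_lintegral_enorm_sq_le (memLp_indicator_one hL)
  rw [lintegral_enorm_indicator_one_sq hL] at h1
  refine le_trans ?_ (mul_le_mul_right h1 _)
  simp_rw [← ENNReal.tsum_mul_left]
  refine ENNReal.tsum_le_tsum fun i => ENNReal.tsum_le_tsum fun j => ?_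
  have hm : Measurable fun ω => (levelProb μ 𝓕 L i j ω - levelProb μ 𝓕 L (i - 1) j ω) -
      (levelProb μ 𝓕 L i (j - 1) ω - levelProb μ 𝓕 L (i - 1) (j - 1) ω) :=
    ((h.measurable_levelProb i j).fun_sub (h.measurable_levelProb (i - 1) j)).fun_sub
      ((h.measurable_levelProb i (j - 1)).fun_sub (h.measurable_levelProb (i - 1) (j - 1)))
  have h2 := measure_exists_lt_le n hn (μ := μ) (u := fun (_ : Unit) ω =>
    (levelProb μ 𝓕 L i j ω - levelProb μ 𝓕 L (i - 1) j ω) -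
      (levelProb μ 𝓕 L i (j - 1) ω - levelProb μ 𝓕 L (i - 1) (j - 1) ω))
      (by simpa only [ciSup_unique] using hm.enorm)
  simpa only [exists_const, ciSup_unique, levelProb] using h2

theorem IsF4Filtration.lintegral_indicator_le_two_mul (h : IsF4Filtration μ 𝓕)
    (hL : MeasurableSet L) {i j : ℕ} {s : Set Ω} (hs : MeasurableSet[𝓕 i j] s)
    (hsL : ∀ ω ∈ s, levelProb μ 𝓕 L i j ω ≤ 1 / 2) {φ : Ω → ℝ≥0∞} (hφ : Measurable[𝓕 i j] φ) :
    ∫⁻ ω, s.indicator φ ω ∂μ ≤ 2 * ∫⁻ ω, (s \ L).indicator φ ω ∂μ := by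
  have hs0 := h.le i j s hs
  have hφ0 : Measurable φ := hφ.mono (h.le i j) le_rfl
  have hkey : ∀ t, MeasurableSet[𝓕 i j] t → t ⊆ s → μ t ≤ 2 * μ (t \ L) := by
    intro t ht hts
    have ht0 := h.le i j t ht
    have h_int : Integrable (L.indicator (1 : Ω → ℝ)) μ :=
      (memLp_indicator_one hL).integrable one_le_two
    have h1 : ∫ ω in t, levelProb μ 𝓕 L i j ω ∂μ = μ.real (t ∩ L) := by
      rw [levelProb, setIntegral_condExp (h.le i j) h_int ht, setIntegral_indicator hL]
      simp
    have h2 : ∫ ω in t, levelProb μ 𝓕 L i j ω ∂μ ≤ ∫ ω in t, (1 / 2 : ℝ) ∂μ :=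
      setIntegral_mono_on integrable_condExp.integrableOn (integrable_const _).integrableOn ht0
        fun ω hω => hsL ω (hts hω)
    rw [setIntegral_const, smul_eq_mul] at h2
    have h3 : μ.real (t ∩ L) + μ.real (t \ L) = μ.real t := measureReal_inter_add_sdiff hL
    have h4 : μ.real t ≤ 2 * μ.real (t \ L) := by linarith
    rw [← ofReal_measureReal (μ := μ) (s := t), ← ofReal_measureReal (μ := μ) (s := t \ L)]
    calc ENNReal.ofReal (μ.real t) ≤ ENNReal.ofReal (2 * μ.real (t \ L)) :=
          ENNReal.ofReal_le_ofReal h4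
      _ = _ := by rw [ENNReal.ofReal_mul (by norm_num)]; simp
  have h1 := lintegral_mul_le_of_setLIntegral_le (μ := μ) (h.le i j)
    (f := s.indicator 1) (g := fun ω => 2 * (s \ L).indicator 1 ω)
    (measurable_one.indicator hs0)
    ((measurable_one.indicator (hs0.diff hL)).const_mul 2) (fun t ht => ?_) hφ
  · calc ∫⁻ ω, s.indicator φ ω ∂μ = ∫⁻ ω, φ ω * s.indicator 1 ω ∂μ := by
          refine lintegral_congr fun ω => ?_
          by_cases hω : ω ∈ s <;> simp [hω]
      _ ≤ ∫⁻ ω, φ ω * (2 * (s \ L).indicator 1 ω) ∂μ := h1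
      _ = ∫⁻ ω, 2 * (s \ L).indicator φ ω ∂μ := by
          refine lintegral_congr fun ω => ?_
          by_cases hω : ω ∈ s \ L
          · simp [Set.indicator_of_mem hω, mul_comm]
          · simp [Set.indicator_of_notMem hω]
      _ = _ := lintegral_const_mul _ (hφ0.indicator (hs0.diff hL))
  · have e1 : (s \ L) ∩ t = (t ∩ s) \ L := by
      ext ω; simp only [Set.mem_inter_iff, Set.mem_sdiff]; tauto
    rw [lintegral_const_mul _ (measurable_one.indicator (hs0.diff hL)),
      lintegral_indicator_one hs0, lintegral_indicator_one (hs0.diff hL),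
      Measure.restrict_apply hs0, Measure.restrict_apply (hs0.diff hL), e1, Set.inter_comm s t]
    exact hkey _ (ht.inter hs) Set.inter_subset_right

end LevelProb

section LevelCost

variable {Ω : Type*} [m0 : MeasurableSpace Ω] {μ : Measure Ω} [IsProbabilityMeasure μ]
  {𝓕 : ℕ → ℕ → MeasurableSpace Ω} {L : ℤ → Set Ω} {Y : ℕ → ℕ → Ω → ℝ≥0∞}
  {p : ℤ → ℕ → ℕ → Ω → ℝ≥0∞}

theorem IsF4Filtration.lintegral_econdExp_pred_pred_le (h : IsF4Filtration μ 𝓕)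
    (hL : ∀ k, MeasurableSet (L k)) (hY : ∀ i j, Measurable (Y i j))
    (hp : ∀ k i j, Measurable (p k i j))
    (hYp : ∀ i j ω, Y i j ω ≤ ∑' k,
      {ω | (8 : ℝ)⁻¹ < levelProb μ 𝓕 (L k) (i - 1) (j - 1) ω}.indicator (p k i j) ω) :
    ∫⁻ ω, (∑' (i : ℕ) (j : ℕ), econdExp μ (𝓕 (i - 1) (j - 1)) (Y i j) ω) ^ (1/2 : ℝ) ∂μ ≤
      ∑' k : ℤ, ((2 : ℝ≥0∞) ^ k * (1024 * μ (L k)) +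
        ((2 : ℝ≥0∞) ^ k)⁻¹ * ∑' (i : ℕ) (j : ℕ), ∫⁻ ω, p k i j ω ∂μ) := by
  let U : ℤ → Set Ω := fun k => {ω | ∃ i j, (8 : ℝ)⁻¹ < levelProb μ 𝓕 (L k) i j ω}
  have hU : ∀ k, MeasurableSet (U k) := fun k => by
    simp only [U, Set.ofPred_exists]
    exact MeasurableSet.iUnion fun i => MeasurableSet.iUnion fun j =>
      measurableSet_lt measurable_const (h.measurable_levelProb i j)
  have hμU : ∀ k, μ (U k) ≤ 1024 * μ (L k) := fun k => by
    have h1 := h.measure_exists_lt_levelProb_le (hL k) 8 (by norm_num)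
    simp only [Nat.cast_ofNat] at h1
    refine h1.trans (le_of_eq ?_)
    rw [← mul_assoc]; norm_num
  have h2 := lintegral_rpow_half_tsum_econdExp_le_of_le_tsum_indicator (μ := μ)
    (S := ℕ × ℕ) (m := fun s => 𝓕 (s.1 - 1) (s.2 - 1)) (fun s => h.le _ _) hU
    (Q := fun k s => {ω | (8 : ℝ)⁻¹ < levelProb μ 𝓕 (L k) (s.1 - 1) (s.2 - 1) ω})
    (fun k s => measurableSet_lt measurable_const (_root_.measurable_levelProb _ _))
    (fun k s ω hω => ⟨_, _, hω⟩) (p := fun k s => p k s.1 s.2) (fun k s => hp k _ _)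
    (Y := fun s => Y s.1 s.2) (fun s => hY _ _) (fun s ω => hYp _ _ ω)
  simp only [ENNReal.tsum_prod'] at h2
  exact h2.trans (ENNReal.tsum_le_tsum fun k => add_le_add (mul_le_mul_right (hμU k) _) le_rfl)

theorem IsF4Filtration.tsum_lintegral_econdExp_colSup_le (h : IsF4Filtration μ 𝓕)
    (hL : ∀ k, MeasurableSet (L k)) (hY : ∀ i j, Measurable (Y i j))
    (hp : ∀ k i j, Measurable (p k i j))
    (hYp : ∀ i j ω, Y i j ω ≤ ∑' k,
      {ω | (8 : ℝ)⁻¹ < levelProb μ 𝓕 (L k) i (j - 1) ω -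
        levelProb μ 𝓕 (L k) (i - 1) (j - 1) ω}.indicator (p k i j) ω) :
    ∑' i : ℕ, ∫⁻ ω, (∑' j : ℕ, econdExp μ (colSup 𝓕 (j - 1)) (Y i j) ω) ^ (1/2 : ℝ) ∂μ ≤
      ∑' k : ℤ, ((2 : ℝ≥0∞) ^ k * (256 * μ (L k)) +
        ((2 : ℝ≥0∞) ^ k)⁻¹ * ∑' (i : ℕ) (j : ℕ), ∫⁻ ω, p k i j ω ∂μ) := by
  let U : ℤ → ℕ → Set Ω := fun k i =>
    {ω | ∃ j, (8 : ℝ)⁻¹ < levelProb μ 𝓕 (L k) i j ω - levelProb μ 𝓕 (L k) (i - 1) j ω}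
  have hU : ∀ k i, MeasurableSet (U k i) := fun k i => by
    simp only [U, Set.ofPred_exists]
    exact MeasurableSet.iUnion fun j => measurableSet_lt measurable_const
      ((h.measurable_levelProb i j).fun_sub (h.measurable_levelProb (i - 1) j))
  have hμU : ∀ k, ∑' i, μ (U k i) ≤ 256 * μ (L k) := fun k => by
    have h1 := h.tsum_measure_exists_lt_levelProb_sub_le (hL k) 8 (by norm_num)
    simp only [Nat.cast_ofNat] at h1
    refine h1.trans (le_of_eq ?_)
    rw [← mul_assoc]; norm_num
  calc ∑' i : ℕ, ∫⁻ ω, (∑' j : ℕ, econdExp μ (colSup 𝓕 (j - 1)) (Y i j) ω) ^ (1/2 : ℝ) ∂μ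
      ≤ ∑' i : ℕ, ∑' k : ℤ, ((2 : ℝ≥0∞) ^ k * μ (U k i) +
        ((2 : ℝ≥0∞) ^ k)⁻¹ * ∑' j : ℕ, ∫⁻ ω, p k i j ω ∂μ) := by
        refine ENNReal.tsum_le_tsum fun i => ?_
        refine lintegral_rpow_half_tsum_econdExp_le_of_le_tsum_indicator (μ := μ)
          (m := fun j => colSup 𝓕 (j - 1)) (fun j => h.colSup_le _) (fun k => hU k i)
          (Q := fun k j => {ω | (8 : ℝ)⁻¹ < levelProb μ 𝓕 (L k) i (j - 1) ω -
            levelProb μ 𝓕 (L k) (i - 1) (j - 1) ω})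
          (fun k j => ?_) (fun k j ω hω => ⟨_, hω⟩) (fun k j => hp k i j) (hY i) (hYp i)
        exact measurableSet_lt measurable_const
          (((_root_.measurable_levelProb i (j - 1)).mono (le_colSup 𝓕 _ _) le_rfl).fun_sub
            ((_root_.measurable_levelProb (i - 1) (j - 1)).mono (le_colSup 𝓕 _ _) le_rfl))
    _ = ∑' k : ℤ, ((2 : ℝ≥0∞) ^ k * ∑' i, μ (U k i) +
        ((2 : ℝ≥0∞) ^ k)⁻¹ * ∑' (i : ℕ) (j : ℕ), ∫⁻ ω, p k i j ω ∂μ) := by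
        rw [ENNReal.tsum_comm]
        simp_rw [ENNReal.tsum_add, ENNReal.tsum_mul_left]
    _ ≤ _ := ENNReal.tsum_le_tsum fun k => add_le_add (mul_le_mul_right (hμU k) _) le_rfl

theorem IsF4Filtration.tsum_lintegral_econdExp_rowSup_le (h : IsF4Filtration μ 𝓕)
    (hL : ∀ k, MeasurableSet (L k)) (hY : ∀ i j, Measurable (Y i j))
    (hp : ∀ k i j, Measurable (p k i j))
    (hYp : ∀ i j ω, Y i j ω ≤ ∑' k,
      {ω | (8 : ℝ)⁻¹ < levelProb μ 𝓕 (L k) (i - 1) j ω -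
        levelProb μ 𝓕 (L k) (i - 1) (j - 1) ω}.indicator (p k i j) ω) :
    ∑' j : ℕ, ∫⁻ ω, (∑' i : ℕ, econdExp μ (rowSup 𝓕 (i - 1)) (Y i j) ω) ^ (1/2 : ℝ) ∂μ ≤
      ∑' k : ℤ, ((2 : ℝ≥0∞) ^ k * (256 * μ (L k)) +
        ((2 : ℝ≥0∞) ^ k)⁻¹ * ∑' (i : ℕ) (j : ℕ), ∫⁻ ω, p k i j ω ∂μ) := by
  have h1 := h.swap.tsum_lintegral_econdExp_colSup_le hL (Y := fun i j => Y j i)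
    (p := fun k i j => p k j i) (fun i j => hY j i) (fun k i j => hp k j i)
    (fun i j ω => hYp j i ω)
  refine h1.trans (ENNReal.tsum_le_tsum fun k => ?_)
  rw [ENNReal.tsum_comm]

theorem IsF4Filtration.tsum_tsum_lintegral_enorm_le (h : IsF4Filtration μ 𝓕)
    (hL : ∀ k, MeasurableSet (L k)) {A : ℕ → ℕ → Ω → ℝ}
    (hp : ∀ k i j, Measurable (p k i j))
    (hAp : ∀ i j, ∀ᵐ ω ∂μ, (‖A i j ω‖₊ : ℝ≥0∞) ^ 2 ≤ ∑' k,
      {ω | (8 : ℝ)⁻¹ < (levelProb μ 𝓕 (L k) i j ω - levelProb μ 𝓕 (L k) (i - 1) j ω) -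
        (levelProb μ 𝓕 (L k) i (j - 1) ω - levelProb μ 𝓕 (L k) (i - 1) (j - 1) ω)}.indicator
          (p k i j) ω) :
    ∑' (i : ℕ) (j : ℕ), ∫⁻ ω, (‖A i j ω‖₊ : ℝ≥0∞) ∂μ ≤
      ∑' k : ℤ, ((2 : ℝ≥0∞) ^ k * (64 * μ (L k)) +
        ((2 : ℝ≥0∞) ^ k)⁻¹ * ∑' (i : ℕ) (j : ℕ), ∫⁻ ω, p k i j ω ∂μ) := by
  let U : ℤ → ℕ → ℕ → Set Ω := fun k i j =>
    {ω | (8 : ℝ)⁻¹ < (levelProb μ 𝓕 (L k) i j ω - levelProb μ 𝓕 (L k) (i - 1) j ω) -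
        (levelProb μ 𝓕 (L k) i (j - 1) ω - levelProb μ 𝓕 (L k) (i - 1) (j - 1) ω)}
  have hU : ∀ k i j, MeasurableSet (U k i j) := fun k i j =>
    measurableSet_lt measurable_const
      (((h.measurable_levelProb i j).fun_sub (h.measurable_levelProb (i - 1) j)).fun_sub
      ((h.measurable_levelProb i (j - 1)).fun_sub (h.measurable_levelProb (i - 1) (j - 1))))
  have hμU : ∀ k, ∑' i, ∑' j, μ (U k i j) ≤ 64 * μ (L k) := fun k => by
    have h1 := h.tsum_tsum_measure_lt_levelProb_le (hL k) 8 (by norm_num)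
    simp only [Nat.cast_ofNat] at h1
    refine h1.trans (le_of_eq ?_)
    norm_num
  calc ∑' (i : ℕ) (j : ℕ), ∫⁻ ω, (‖A i j ω‖₊ : ℝ≥0∞) ∂μ
      ≤ ∑' (i : ℕ) (j : ℕ) (k : ℤ), ((2 : ℝ≥0∞) ^ k * μ (U k i j) +
        ((2 : ℝ≥0∞) ^ k)⁻¹ * ∫⁻ ω, p k i j ω ∂μ) := by
        refine ENNReal.tsum_le_tsum fun i => ENNReal.tsum_le_tsum fun j => ?_
        have h1 := lintegral_rpow_half_tsum_le_of_le_tsum_indicator (μ := μ) (S := Unit)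
          (fun k => hU k i j) (r := fun k _ => p k i j) (fun k _ => hp k i j)
          (e := fun _ ω => (‖A i j ω‖₊ : ℝ≥0∞) ^ 2) (fun _ => hAp i j)
        simpa only [tsum_fintype, Finset.univ_unique, Finset.sum_singleton, sq_rpow_half] using h1
    _ = ∑' k : ℤ, ((2 : ℝ≥0∞) ^ k * ∑' i, ∑' j, μ (U k i j) +
        ((2 : ℝ≥0∞) ^ k)⁻¹ * ∑' (i : ℕ) (j : ℕ), ∫⁻ ω, p k i j ω ∂μ) := by
        simp_rw [ENNReal.tsum_comm (α := ℕ) (β := ℤ), ENNReal.tsum_add, ENNReal.tsum_mul_left]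
    _ ≤ _ := ENNReal.tsum_le_tsum fun k => add_le_add (mul_le_mul_right (hμU k) _) le_rfl

end LevelCost

/-- The set where the square function of `X` exceeds `2 ^ k`. -/
def squareLevelSet {Ω : Type*} (X : ℕ → ℕ → Ω → ℝ) (k : ℤ) : Set Ω :=
  {ω | (2 : ℝ≥0∞) ^ k < (∑' (i : ℕ) (j : ℕ), (‖X i j ω‖₊ : ℝ≥0∞) ^ 2) ^ (1/2 : ℝ)}

/-- The set where the conditional probability at `(i, j)` of the level set of the square function
of `X` drops below `1 / 2` between the levels `2 ^ k` and `2 ^ (k + 1)`. -/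
def levelStage {Ω : Type*} [MeasurableSpace Ω] (μ : Measure Ω) (𝓕 : ℕ → ℕ → MeasurableSpace Ω)
    (X : ℕ → ℕ → Ω → ℝ) (k : ℤ) (i j : ℕ) : Set Ω :=
  {ω | (2 : ℝ)⁻¹ < levelProb μ 𝓕 (squareLevelSet X k) i j ω ∧
    levelProb μ 𝓕 (squareLevelSet X (k + 1)) i j ω ≤ 1 / 2}

section Stage

variable {Ω : Type*} [m0 : MeasurableSpace Ω] {μ : Measure Ω}
  {𝓕 : ℕ → ℕ → MeasurableSpace Ω} {X : ℕ → ℕ → Ω → ℝ}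

theorem measurable_nnnorm_sq {m : MeasurableSpace Ω} {f : Ω → ℝ} (hf : Measurable[m] f) :
    Measurable[m] fun ω => (‖f ω‖₊ : ℝ≥0∞) ^ 2 :=
  hf.enorm.pow_const 2

theorem measurableSet_lt_nnnorm {m : MeasurableSpace Ω} {f : Ω → ℝ} (hf : Measurable[m] f)
    (a : ℝ≥0∞) : MeasurableSet[m] {ω | a < ‖f ω‖₊} :=
  measurableSet_lt measurable_const hf.enorm

theorem measurable_indicator_one {m : MeasurableSpace Ω} {s : Set Ω} (hs : MeasurableSet[m] s) :
    Measurable[m] (s.indicator (1 : Ω → ℝ)) :=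
  measurable_one.indicator hs

theorem measurable_square_function (hX : ∀ i j, Measurable (X i j)) :
    Measurable fun ω => (∑' (i : ℕ) (j : ℕ), (‖X i j ω‖₊ : ℝ≥0∞) ^ 2) ^ (1/2 : ℝ) :=
  (measurable_ennreal_tsum fun i => measurable_ennreal_tsum fun j =>
    measurable_nnnorm_sq (hX i j)).pow_const _

theorem measurableSet_squareLevelSet (hX : ∀ i j, Measurable (X i j)) (k : ℤ) :
    MeasurableSet (squareLevelSet X k) :=
  measurableSet_lt measurable_const (measurable_square_function hX)

theorem tsum_zpow_mul_measure_squareLevelSet_le (hX : ∀ i j, Measurable (X i j)) :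
    ∑' k : ℤ, (2 : ℝ≥0∞) ^ k * μ (squareLevelSet X k) ≤
      2 * ∫⁻ ω, (∑' (i : ℕ) (j : ℕ), (‖X i j ω‖₊ : ℝ≥0∞) ^ 2) ^ (1/2 : ℝ) ∂μ := by
  classical
  have hL := measurableSet_squareLevelSet hX
  calc ∑' k : ℤ, (2 : ℝ≥0∞) ^ k * μ (squareLevelSet X k)
      = ∑' k : ℤ, ∫⁻ ω, (squareLevelSet X k).indicator (fun _ => (2 : ℝ≥0∞) ^ k) ω ∂μ :=
        tsum_congr fun k => (lintegral_indicator_const (hL k) _).symm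
    _ = ∫⁻ ω, ∑' k : ℤ, (squareLevelSet X k).indicator (fun _ => (2 : ℝ≥0∞) ^ k) ω ∂μ :=
        (lintegral_tsum fun k => (measurable_const.indicator (hL k)).aemeasurable).symm
    _ ≤ ∫⁻ ω, 2 * (∑' (i : ℕ) (j : ℕ), (‖X i j ω‖₊ : ℝ≥0∞) ^ 2) ^ (1/2 : ℝ) ∂μ := by
        refine lintegral_mono fun ω => ?_
        refine (tsum_congr fun k => ?_).trans_le (tsum_zpow_two_indicator_lt_le _)
        rw [Set.indicator_apply]
        exact if_congr Iff.rfl rfl rfl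
    _ = _ := lintegral_const_mul _ (measurable_square_function hX)

variable [IsProbabilityMeasure μ]

theorem measurableSet_levelStage (k : ℤ) (i j : ℕ) :
    MeasurableSet[𝓕 i j] (levelStage μ 𝓕 X k i j) :=
  @MeasurableSet.inter _ (𝓕 i j) _ _
    (measurableSet_lt measurable_const (measurable_levelProb _ _))
    (measurableSet_le (measurable_levelProb _ _) measurable_const)

theorem IsF4Filtration.tsum_tsum_lintegral_levelStage_le (h : IsF4Filtration μ 𝓕)
    (hX : ∀ i j, Measurable[𝓕 i j] (X i j)) (k : ℤ) :
    ∑' (i : ℕ) (j : ℕ), ∫⁻ ω, (levelStage μ 𝓕 X k i j).indicator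
      (fun ω => (‖X i j ω‖₊ : ℝ≥0∞) ^ 2) ω ∂μ ≤
      ((2 : ℝ≥0∞) ^ k) ^ 2 * (512 * μ (squareLevelSet X k)) := by
  have hX0 : ∀ i j, Measurable (X i j) := fun i j => (hX i j).mono (h.le i j) le_rfl
  have hL := measurableSet_squareLevelSet hX0
  set E : Set Ω := {ω | ∃ i j, (2 : ℝ)⁻¹ < levelProb μ 𝓕 (squareLevelSet X k) i j ω} with hE
  have hEm : MeasurableSet E := by
    simp only [E, Set.ofPred_exists]
    exact MeasurableSet.iUnion fun i => MeasurableSet.iUnion fun j =>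
      measurableSet_lt measurable_const (h.measurable_levelProb i j)
  have hμE : μ E ≤ 64 * μ (squareLevelSet X k) := by
    have h1 := h.measure_exists_lt_levelProb_le (hL k) 2 (by norm_num)
    simp only [Nat.cast_ofNat] at h1
    refine h1.trans (le_of_eq ?_)
    rw [← mul_assoc]; norm_num
  let G : ℕ → ℕ → Ω → ℝ≥0∞ := fun i j =>
    (levelStage μ 𝓕 X k i j \ squareLevelSet X (k + 1)).indicator
      fun ω => (‖X i j ω‖₊ : ℝ≥0∞) ^ 2
  have hGm : ∀ i j, Measurable (G i j) := fun i j =>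
    (measurable_nnnorm_sq (hX0 i j)).indicator
      ((h.le i j _ (measurableSet_levelStage k i j)).diff (hL (k + 1)))
  have hpt : ∀ ω, ∑' (i : ℕ) (j : ℕ), G i j ω ≤
      E.indicator (fun _ => ((2 : ℝ≥0∞) ^ (k + 1)) ^ 2) ω := by
    intro ω
    by_cases hω : ω ∈ E \ squareLevelSet X (k + 1)
    · rw [Set.indicator_of_mem hω.1]
      have h1 : (∑' (i : ℕ) (j : ℕ), (‖X i j ω‖₊ : ℝ≥0∞) ^ 2) ^ (1/2 : ℝ) ≤ (2 : ℝ≥0∞) ^ (k + 1) :=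
        not_lt.1 hω.2
      calc ∑' (i : ℕ) (j : ℕ), G i j ω ≤ ∑' (i : ℕ) (j : ℕ), (‖X i j ω‖₊ : ℝ≥0∞) ^ 2 :=
            ENNReal.tsum_le_tsum fun i => ENNReal.tsum_le_tsum fun j =>
              Set.indicator_le_self _ _ ω
        _ = ((∑' (i : ℕ) (j : ℕ), (‖X i j ω‖₊ : ℝ≥0∞) ^ 2) ^ (1/2 : ℝ)) ^ 2 := by
            rw [← ENNReal.rpow_natCast, ← ENNReal.rpow_mul]; norm_num
        _ ≤ _ := pow_le_pow_left' h1 2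
    · have h0 : ∀ i j, G i j ω = 0 := fun i j =>
        Set.indicator_of_notMem (fun hmem => hω ⟨⟨i, j, hmem.1.1⟩, hmem.2⟩) _
      simp [h0]
  calc ∑' (i : ℕ) (j : ℕ), ∫⁻ ω, (levelStage μ 𝓕 X k i j).indicator
          (fun ω => (‖X i j ω‖₊ : ℝ≥0∞) ^ 2) ω ∂μ
      ≤ ∑' (i : ℕ) (j : ℕ), 2 * ∫⁻ ω, G i j ω ∂μ :=
        ENNReal.tsum_le_tsum fun i => ENNReal.tsum_le_tsum fun j =>
          h.lintegral_indicator_le_two_mul (hL (k + 1)) (measurableSet_levelStage k i j)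
            (fun ω hω => hω.2) (measurable_nnnorm_sq (hX i j))
    _ = 2 * ∫⁻ ω, ∑' (i : ℕ) (j : ℕ), G i j ω ∂μ := by
        rw [lintegral_tsum fun i => (measurable_ennreal_tsum (hGm i)).aemeasurable]
        simp_rw [ENNReal.tsum_mul_left]
        congr 2; funext i
        rw [lintegral_tsum fun j => (hGm i j).aemeasurable]
    _ ≤ 2 * (((2 : ℝ≥0∞) ^ (k + 1)) ^ 2 * μ E) := by
        rw [← lintegral_indicator_const hEm]
        exact mul_le_mul_right (lintegral_mono hpt) _
    _ ≤ 2 * (((2 : ℝ≥0∞) ^ (k + 1)) ^ 2 * (64 * μ (squareLevelSet X k))) :=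
        mul_le_mul_right (mul_le_mul_right hμE _) _
    _ = _ := by
        rw [ENNReal.zpow_add two_ne_zero ENNReal.ofNat_ne_top, zpow_one]
        ring

theorem IsF4Filtration.ae_levelProb_squareLevelSet_eq_one (h : IsF4Filtration μ 𝓕)
    (hX : ∀ i j, Measurable[𝓕 i j] (X i j)) :
    ∀ᵐ ω ∂μ, ∀ (k : ℤ) (i j : ℕ), (2 : ℝ≥0∞) ^ k < ‖X i j ω‖₊ →
      levelProb μ 𝓕 (squareLevelSet X k) i j ω = 1 := by
  have hX0 : ∀ i j, Measurable (X i j) := fun i j => (hX i j).mono (h.le i j) le_rfl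
  have hL := measurableSet_squareLevelSet hX0
  refine ae_all_iff.2 fun k => ae_all_iff.2 fun i => ae_all_iff.2 fun j => ?_
  let s : Set Ω := {ω | (2 : ℝ≥0∞) ^ k < ‖X i j ω‖₊}
  have hs : MeasurableSet[𝓕 i j] s := measurableSet_lt_nnnorm (hX i j) _
  have hsL : s ⊆ squareLevelSet X k := fun ω hω => by
    refine lt_of_lt_of_le (show (2 : ℝ≥0∞) ^ k < ‖X i j ω‖₊ from hω) ?_
    calc (‖X i j ω‖₊ : ℝ≥0∞) = ((‖X i j ω‖₊ : ℝ≥0∞) ^ 2) ^ (1/2 : ℝ) := (sq_rpow_half _).symm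
      _ ≤ _ := ENNReal.rpow_le_rpow
        ((ENNReal.le_tsum (f := fun j => (‖X i j ω‖₊ : ℝ≥0∞) ^ 2) j).trans
          (ENNReal.le_tsum (f := fun i => ∑' j, (‖X i j ω‖₊ : ℝ≥0∞) ^ 2) i)) (by norm_num)
  have h1 := condExp_indicator ((memLp_indicator_one (μ := μ) (hL k)).integrable one_le_two) hs
  have h2 : s.indicator ((squareLevelSet X k).indicator (1 : Ω → ℝ)) = s.indicator 1 := by
    rw [Set.indicator_indicator, Set.inter_eq_left.2 hsL]
  rw [h2, condExp_of_stronglyMeasurable (h.le i j) (measurable_indicator_one hs).stronglyMeasurable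
    ((memLp_indicator_one (h.le i j s hs)).integrable one_le_two)] at h1
  filter_upwards [h1] with ω hω hmem
  have hmem' : ω ∈ s := hmem
  simpa [Set.indicator_of_mem hmem', levelProb] using hω.symm

theorem IsF4Filtration.ae_exists_levelProb_squareLevelSet_le (h : IsF4Filtration μ 𝓕)
    (hX : ∀ i j, Measurable (X i j))
    (hfin : ∫⁻ ω, (∑' (i : ℕ) (j : ℕ), (‖X i j ω‖₊ : ℝ≥0∞) ^ 2) ^ (1/2 : ℝ) ∂μ ≠ ∞) :
    ∀ᵐ ω ∂μ, ∃ k : ℤ, ∀ i j : ℕ, levelProb μ 𝓕 (squareLevelSet X k) i j ω ≤ 1 / 2 := by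
  have hL := measurableSet_squareLevelSet hX
  let E : ℕ → Set Ω := fun n =>
    {ω | ∃ i j, (2 : ℝ)⁻¹ < levelProb μ 𝓕 (squareLevelSet X (n : ℤ)) i j ω}
  have hE : ∀ n, μ (E n) ≤ 64 * ((2 : ℝ≥0∞) ^ (n : ℤ) * μ (squareLevelSet X (n : ℤ))) := fun n => by
    have h1 := h.measure_exists_lt_levelProb_le (hL n) 2 (by norm_num)
    simp only [Nat.cast_ofNat] at h1
    refine h1.trans ?_
    rw [← mul_assoc, show (2 : ℝ≥0∞) ^ 2 * 16 = 64 by norm_num]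
    refine mul_le_mul_right (le_mul_of_one_le_left zero_le ?_) _
    rw [zpow_natCast]
    exact one_le_pow₀ one_le_two
  have hsum : ∑' n, μ (E n) ≠ ∞ := by
    refine ne_top_of_le_ne_top ?_ (ENNReal.tsum_le_tsum hE)
    rw [ENNReal.tsum_mul_left]
    refine ENNReal.mul_ne_top (by norm_num) (ne_top_of_le_ne_top ?_
      (ENNReal.tsum_comp_le_tsum_of_injective Nat.cast_injective
        fun k : ℤ => (2 : ℝ≥0∞) ^ k * μ (squareLevelSet X k)))
    exact ne_top_of_le_ne_top (ENNReal.mul_ne_top (by norm_num) hfin)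
      (tsum_zpow_mul_measure_squareLevelSet_le hX)
  filter_upwards [ae_eventually_notMem hsum] with ω hω
  obtain ⟨n, hn⟩ := hω.exists
  refine ⟨n, fun i j => ?_⟩
  by_contra hlt
  exact hn ⟨i, j, by rw [← one_div]; exact not_le.1 hlt⟩

theorem IsF4Filtration.ae_exists_mem_levelStage (h : IsF4Filtration μ 𝓕)
    (hX : ∀ i j, Measurable[𝓕 i j] (X i j))
    (hfin : ∫⁻ ω, (∑' (i : ℕ) (j : ℕ), (‖X i j ω‖₊ : ℝ≥0∞) ^ 2) ^ (1/2 : ℝ) ∂μ ≠ ∞) :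
    ∀ᵐ ω ∂μ, ∀ i j, X i j ω ≠ 0 → ∃ k, ω ∈ levelStage μ 𝓕 X k i j := by
  have hX0 : ∀ i j, Measurable (X i j) := fun i j => (hX i j).mono (h.le i j) le_rfl
  filter_upwards [h.ae_levelProb_squareLevelSet_eq_one hX,
    h.ae_exists_levelProb_squareLevelSet_le hX0 hfin] with ω h1 h2 i j hne
  obtain ⟨n, hn⟩ := h2
  obtain ⟨k, hk, -⟩ := ENNReal.exists_mem_Ioc_zpow (x := (‖X i j ω‖₊ : ℝ≥0∞)) (y := 2)
    (by simpa using hne) (by simp) (by norm_num) (by norm_num)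
  by_contra! hcon
  have hstep : ∀ l, k ≤ l → (2 : ℝ)⁻¹ < levelProb μ 𝓕 (squareLevelSet X l) i j ω := by
    intro l hl
    induction l, hl using Int.leInduction with
    | base => rw [h1 k i j hk]; norm_num
    | succ l _ ih =>
      by_contra hlt
      exact hcon l ⟨ih, by rw [one_div]; exact not_lt.1 hlt⟩
  have hlt : (2 : ℝ)⁻¹ < levelProb μ 𝓕 (squareLevelSet X n) i j ω := by
    rcases le_total k n with hkn | hnk
    · exact hstep n hkn
    · rw [h1 n i j ((ENNReal.zpow_le_of_le one_le_two hnk).trans_lt hk)]; norm_num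
  have := hn i j
  rw [one_div] at this
  exact absurd this (not_le.2 hlt)

end Stage

section Backward

variable {Ω : Type*} {m : MeasurableSpace Ω} [m0 : MeasurableSpace Ω] {μ : Measure Ω}
  {𝓕 : ℕ → ℕ → MeasurableSpace Ω} {X : ℕ → ℕ → Ω → ℝ}

theorem measurableSet_lt_sub {f g : Ω → ℝ} (hf : Measurable[m] f) (hg : Measurable[m] g) (a : ℝ) :
    MeasurableSet[m] {ω | a < f ω - g ω} :=
  measurableSet_lt measurable_const (hf.fun_sub hg)

theorem measurableSet_iUnion_inter {s t : ℤ → Set Ω} (hs : ∀ k, MeasurableSet[m] (s k))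
    (ht : ∀ k, MeasurableSet[m] (t k)) : MeasurableSet[m] (⋃ k, s k ∩ t k) :=
  MeasurableSet.iUnion fun k => (hs k).inter (ht k)

theorem nnnorm_sq_indicator_le_tsum {f : Ω → ℝ} {s : Set Ω} {T Q : ℤ → Set Ω} {ω : Ω}
    (hs : ω ∈ s → f ω ≠ 0 → ω ∈ ⋃ k, T k ∩ Q k) :
    (‖s.indicator f ω‖₊ : ℝ≥0∞) ^ 2 ≤
      ∑' k, (Q k).indicator ((T k).indicator fun ω => (‖f ω‖₊ : ℝ≥0∞) ^ 2) ω := by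
  by_cases hω : ω ∈ s
  · by_cases h0 : f ω = 0
    · simp [Set.indicator_of_mem hω, h0]
    · obtain ⟨k, hT, hQ⟩ := Set.mem_iUnion.1 (hs hω h0)
      refine le_trans (le_of_eq ?_) (ENNReal.le_tsum k)
      rw [Set.indicator_of_mem hω, Set.indicator_of_mem hQ, Set.indicator_of_mem hT]
  · simp [Set.indicator_of_notMem hω]

variable [IsProbabilityMeasure μ]

theorem IsF4Filtration.exists_decompCost_le (h : IsF4Filtration μ 𝓕)
    (hX : ∀ i j, Measurable[𝓕 i j] (X i j))
    (hfin : ∫⁻ ω, (∑' (i : ℕ) (j : ℕ), (‖X i j ω‖₊ : ℝ≥0∞) ^ 2) ^ (1/2 : ℝ) ∂μ ≠ ∞) :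
    ∃ A B C D : ℕ → ℕ → Ω → ℝ,
      (∀ i j, Measurable[𝓕 i j] (A i j)) ∧ (∀ i j, Measurable[𝓕 i j] (B i j)) ∧
      (∀ i j, Measurable[𝓕 i j] (C i j)) ∧ (∀ i j, Measurable[𝓕 i j] (D i j)) ∧
      (∀ i j ω, X i j ω = A i j ω + B i j ω + C i j ω + D i j ω) ∧
      decompCost μ 𝓕 A B C D ≤
        7296 * ∫⁻ ω, (∑' (i : ℕ) (j : ℕ), (‖X i j ω‖₊ : ℝ≥0∞) ^ 2) ^ (1/2 : ℝ) ∂μ := by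
  have hX0 : ∀ i j, Measurable (X i j) := fun i j => (hX i j).mono (h.le i j) le_rfl
  set L : ℤ → Set Ω := squareLevelSet X with hLdef
  have hL : ∀ k, MeasurableSet (L k) := measurableSet_squareLevelSet hX0
  let w : ℤ → ℕ → ℕ → Ω → ℝ := fun k i j => levelProb μ 𝓕 (L k) i j
  have hw : ∀ k {i j i' j'}, i' ≤ i → j' ≤ j → Measurable[𝓕 i j] (w k i' j') :=
    fun k i j i' j' hi hj => (_root_.measurable_levelProb i' j').mono (h.mono hi hj) le_rfl
  let T : ℤ → ℕ → ℕ → Set Ω := levelStage μ 𝓕 X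
  have hT : ∀ k i j, MeasurableSet[𝓕 i j] (T k i j) := measurableSet_levelStage
  let QA : ℤ → ℕ → ℕ → Set Ω := fun k i j =>
    {ω | (8 : ℝ)⁻¹ < (w k i j ω - w k (i - 1) j ω) - (w k i (j - 1) ω - w k (i - 1) (j - 1) ω)}
  let QB : ℤ → ℕ → ℕ → Set Ω := fun k i j => {ω | (8 : ℝ)⁻¹ < w k (i - 1) (j - 1) ω}
  let QC : ℤ → ℕ → ℕ → Set Ω := fun k i j =>
    {ω | (8 : ℝ)⁻¹ < w k i (j - 1) ω - w k (i - 1) (j - 1) ω}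
  let QD : ℤ → ℕ → ℕ → Set Ω := fun k i j =>
    {ω | (8 : ℝ)⁻¹ < w k (i - 1) j ω - w k (i - 1) (j - 1) ω}
  have hcover : ∀ k i j ω, ω ∈ T k i j → ω ∉ QB k i j → ω ∉ QC k i j → ω ∉ QD k i j →
      ω ∈ QA k i j := by
    intro k i j ω hT hB hC hD
    have h1 : (2 : ℝ)⁻¹ < w k i j ω := hT.1
    have h2 : w k (i - 1) (j - 1) ω ≤ (8 : ℝ)⁻¹ := not_lt.1 hB
    have h3 : w k i (j - 1) ω - w k (i - 1) (j - 1) ω ≤ (8 : ℝ)⁻¹ := not_lt.1 hC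
    have h4 : w k (i - 1) j ω - w k (i - 1) (j - 1) ω ≤ (8 : ℝ)⁻¹ := not_lt.1 hD
    show (8 : ℝ)⁻¹ < (w k i j ω - w k (i - 1) j ω) -
      (w k i (j - 1) ω - w k (i - 1) (j - 1) ω)
    norm_num at h1 h2 h3 h4 ⊢
    linarith
  let SB : ℕ → ℕ → Set Ω := fun i j => ⋃ k, T k i j ∩ QB k i j
  let SC : ℕ → ℕ → Set Ω := fun i j => ⋃ k, T k i j ∩ QC k i j
  let SD : ℕ → ℕ → Set Ω := fun i j => ⋃ k, T k i j ∩ QD k i j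
  have hSB : ∀ i j, MeasurableSet[𝓕 i j] (SB i j) := fun i j =>
    measurableSet_iUnion_inter (fun k => hT k i j) fun k =>
      measurableSet_lt measurable_const (hw k (Nat.sub_le i 1) (Nat.sub_le j 1))
  have hSC : ∀ i j, MeasurableSet[𝓕 i j] (SC i j) := fun i j =>
    measurableSet_iUnion_inter (fun k => hT k i j) fun k =>
      measurableSet_lt_sub (hw k le_rfl (Nat.sub_le j 1))
        (hw k (Nat.sub_le i 1) (Nat.sub_le j 1)) _
  have hSD : ∀ i j, MeasurableSet[𝓕 i j] (SD i j) := fun i j =>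
    measurableSet_iUnion_inter (fun k => hT k i j) fun k =>
      measurableSet_lt_sub (hw k (Nat.sub_le i 1) le_rfl)
        (hw k (Nat.sub_le i 1) (Nat.sub_le j 1)) _
  let A : ℕ → ℕ → Ω → ℝ := fun i j => ((SB i j ∪ SC i j) ∪ SD i j)ᶜ.indicator (X i j)
  let B : ℕ → ℕ → Ω → ℝ := fun i j => (SB i j).indicator (X i j)
  let C : ℕ → ℕ → Ω → ℝ := fun i j => (SC i j \ SB i j).indicator (X i j)
  let D : ℕ → ℕ → Ω → ℝ := fun i j => (SD i j \ (SB i j ∪ SC i j)).indicator (X i j)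
  have hA : ∀ i j, Measurable[𝓕 i j] (A i j) := fun i j =>
    (hX i j).indicator (((hSB i j).union (hSC i j)).union (hSD i j)).compl
  have hB : ∀ i j, Measurable[𝓕 i j] (B i j) := fun i j => (hX i j).indicator (hSB i j)
  have hC : ∀ i j, Measurable[𝓕 i j] (C i j) := fun i j =>
    (hX i j).indicator ((hSC i j).diff (hSB i j))
  have hD : ∀ i j, Measurable[𝓕 i j] (D i j) := fun i j =>
    (hX i j).indicator ((hSD i j).diff ((hSB i j).union (hSC i j)))
  refine ⟨A, B, C, D, hA, hB, hC, hD, fun i j ω => ?_, ?_⟩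
  · simp only [A, B, C, D]
    by_cases h1 : ω ∈ SB i j <;> by_cases h2 : ω ∈ SC i j <;> by_cases h3 : ω ∈ SD i j <;>
      simp [h1, h2, h3]
  let p : ℤ → ℕ → ℕ → Ω → ℝ≥0∞ := fun k i j =>
    (T k i j).indicator fun ω => (‖X i j ω‖₊ : ℝ≥0∞) ^ 2
  have hp : ∀ k i j, Measurable (p k i j) := fun k i j =>
    (measurable_nnnorm_sq (hX0 i j)).indicator (h.le i j _ (hT k i j))
  have hsq : ∀ {Y : ℕ → ℕ → Ω → ℝ}, (∀ i j, Measurable[𝓕 i j] (Y i j)) → ∀ i j,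
      Measurable fun ω => (‖Y i j ω‖₊ : ℝ≥0∞) ^ 2 := fun hY i j =>
    measurable_nnnorm_sq ((hY i j).mono (h.le i j) le_rfl)
  have costA := h.tsum_tsum_lintegral_enorm_le hL hp (A := A) fun i j => by
    filter_upwards [h.ae_exists_mem_levelStage hX hfin] with ω hω
    refine nnnorm_sq_indicator_le_tsum (Q := fun k => QA k i j) fun hmem hne => ?_
    obtain ⟨k, hk⟩ := hω i j hne
    refine Set.mem_iUnion.2 ⟨k, hk, hcover k i j ω hk ?_ ?_ ?_⟩
    · exact fun hq => hmem (Or.inl (Or.inl (Set.mem_iUnion.2 ⟨k, hk, hq⟩)))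
    · exact fun hq => hmem (Or.inl (Or.inr (Set.mem_iUnion.2 ⟨k, hk, hq⟩)))
    · exact fun hq => hmem (Or.inr (Set.mem_iUnion.2 ⟨k, hk, hq⟩))
  have costB := h.lintegral_econdExp_pred_pred_le hL (hsq hB) hp fun i j ω =>
    nnnorm_sq_indicator_le_tsum (Q := fun k => QB k i j) fun hmem _ => hmem
  have costC := h.tsum_lintegral_econdExp_colSup_le hL (hsq hC) hp fun i j ω =>
    nnnorm_sq_indicator_le_tsum (Q := fun k => QC k i j) fun hmem _ => hmem.1
  have costD := h.tsum_lintegral_econdExp_rowSup_le hL (hsq hD) hp fun i j ω =>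
    nnnorm_sq_indicator_le_tsum (Q := fun k => QD k i j) fun hmem _ => hmem.1
  have hsum : ∀ c : ℝ≥0∞, ∑' k : ℤ, ((2 : ℝ≥0∞) ^ k * (c * μ (L k)) +
      ((2 : ℝ≥0∞) ^ k)⁻¹ * ∑' (i : ℕ) (j : ℕ), ∫⁻ ω, p k i j ω ∂μ) ≤
      (c + 512) * ∑' k : ℤ, (2 : ℝ≥0∞) ^ k * μ (L k) := by
    intro c
    rw [← ENNReal.tsum_mul_left]
    refine ENNReal.tsum_le_tsum fun k => ?_
    have h2 : ((2 : ℝ≥0∞) ^ k)⁻¹ * (2 : ℝ≥0∞) ^ k = 1 :=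
      ENNReal.inv_mul_cancel (ENNReal.zpow_pos (by simp) (by simp) k).ne'
        (ENNReal.zpow_ne_top (by simp) (by simp) k)
    calc (2 : ℝ≥0∞) ^ k * (c * μ (L k)) +
          ((2 : ℝ≥0∞) ^ k)⁻¹ * ∑' (i : ℕ) (j : ℕ), ∫⁻ ω, p k i j ω ∂μ
        ≤ (2 : ℝ≥0∞) ^ k * (c * μ (L k)) +
          ((2 : ℝ≥0∞) ^ k)⁻¹ * (((2 : ℝ≥0∞) ^ k) ^ 2 * (512 * μ (L k))) :=
          add_le_add le_rfl (mul_le_mul_right (h.tsum_tsum_lintegral_levelStage_le hX k) _)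
      _ = (2 : ℝ≥0∞) ^ k * (c * μ (L k)) +
          (((2 : ℝ≥0∞) ^ k)⁻¹ * (2 : ℝ≥0∞) ^ k) * ((2 : ℝ≥0∞) ^ k * (512 * μ (L k))) := by ring
      _ = (c + 512) * ((2 : ℝ≥0∞) ^ k * μ (L k)) := by rw [h2]; ring
  calc decompCost μ 𝓕 A B C D
      ≤ (64 + 512) * (∑' k : ℤ, (2 : ℝ≥0∞) ^ k * μ (L k)) +
        (1024 + 512) * (∑' k : ℤ, (2 : ℝ≥0∞) ^ k * μ (L k)) +
        (256 + 512) * (∑' k : ℤ, (2 : ℝ≥0∞) ^ k * μ (L k)) +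
        (256 + 512) * (∑' k : ℤ, (2 : ℝ≥0∞) ^ k * μ (L k)) :=
        add_le_add (add_le_add (add_le_add (costA.trans (hsum _)) (costB.trans (hsum _)))
          (costC.trans (hsum _))) (costD.trans (hsum _))
    _ = 3648 * ∑' k : ℤ, (2 : ℝ≥0∞) ^ k * μ (L k) := by ring
    _ ≤ 3648 * (2 * ∫⁻ ω, (∑' (i : ℕ) (j : ℕ), (‖X i j ω‖₊ : ℝ≥0∞) ^ 2) ^ (1/2 : ℝ) ∂μ) :=
        mul_le_mul_right (tsum_zpow_mul_measure_squareLevelSet_le hX0) _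
    _ = _ := by ring

end Backward

/-- For an (F4) two-parameter filtration and any adapted sequence
`(X_{i,j})`, the quantity `𝔼[(Σ_{i,j} X_{i,j}²)^{1/2}]` is equivalent, with universal
constants, to the infimum of `decompCost` over all decompositions
`X = A + B + C + D` into adapted sequences. -/
theorem square_function_interpolation_sum :
    ∃ C : ℝ≥0∞, 0 < C ∧ C ≠ ∞ ∧
      ∀ (Ω : Type*) [MeasurableSpace Ω] (μ : Measure Ω) [IsProbabilityMeasure μ]
        (𝓕 : ℕ → ℕ → MeasurableSpace Ω), IsF4Filtration μ 𝓕 →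
        ∀ X : ℕ → ℕ → Ω → ℝ, (∀ i j, Measurable[𝓕 i j] (X i j)) →
          ((∀ A B C' D : ℕ → ℕ → Ω → ℝ,
              (∀ i j, Measurable[𝓕 i j] (A i j)) → (∀ i j, Measurable[𝓕 i j] (B i j)) →
              (∀ i j, Measurable[𝓕 i j] (C' i j)) → (∀ i j, Measurable[𝓕 i j] (D i j)) →
              (∀ i j ω, X i j ω = A i j ω + B i j ω + C' i j ω + D i j ω) →
              ∫⁻ ω, (∑' (i : ℕ) (j : ℕ), (‖X i j ω‖₊ : ℝ≥0∞) ^ 2) ^ (1/2 : ℝ) ∂μ ≤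
                C * decompCost μ 𝓕 A B C' D)
            ∧ (∃ A B C' D : ℕ → ℕ → Ω → ℝ,
              (∀ i j, Measurable[𝓕 i j] (A i j)) ∧ (∀ i j, Measurable[𝓕 i j] (B i j)) ∧
              (∀ i j, Measurable[𝓕 i j] (C' i j)) ∧ (∀ i j, Measurable[𝓕 i j] (D i j)) ∧
              (∀ i j ω, X i j ω = A i j ω + B i j ω + C' i j ω + D i j ω) ∧
              decompCost μ 𝓕 A B C' D ≤
                C * ∫⁻ ω, (∑' (i : ℕ) (j : ℕ), (‖X i j ω‖₊ : ℝ≥0∞) ^ 2) ^ (1/2 : ℝ) ∂μ)) := by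
  refine ⟨10000, by norm_num, by norm_num, fun Ω _ μ _ 𝓕 h X hX => ⟨?_, ?_⟩⟩
  · intro A B C D hA hB hC hD hsum
    have h0 : ∀ {Y : ℕ → ℕ → Ω → ℝ}, (∀ i j, Measurable[𝓕 i j] (Y i j)) →
        ∀ i j, Measurable (Y i j) := fun hY i j => (hY i j).mono (h.le i j) le_rfl
    refine (h.lintegral_square_function_le_decompCost (h0 hA) (h0 hB) (h0 hC) (h0 hD) hsum).trans
      (mul_le_mul_left ?_ _)
    norm_num
  · by_cases hfin : ∫⁻ ω, (∑' (i : ℕ) (j : ℕ), (‖X i j ω‖₊ : ℝ≥0∞) ^ 2) ^ (1/2 : ℝ) ∂μ = ∞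
    · refine ⟨X, 0, 0, 0, hX, fun i j => measurable_const, fun i j => measurable_const,
        fun i j => measurable_const, fun i j ω => by simp, ?_⟩
      rw [hfin, ENNReal.mul_top (by norm_num)]
      exact le_top
    · obtain ⟨A, B, C, D, hA, hB, hC, hD, hsum, hcost⟩ := h.exists_decompCost_le hX hfin
      refine ⟨A, B, C, D, hA, hB, hC, hD, hsum, hcost.trans (mul_le_mul_left ?_ _)⟩
      norm_num
end

section
/- (Davis inequality.) Let (ℱ_k)_{k≥0} be a filtration on a probability space with ℱ_0 = {∅, Ω}, and let f ∈ L¹(⋁_k ℱ_k). Then with universal two-sided constants, 𝔼[sup_n |𝔼_n f|] ≃ 𝔼[(Σ_k |Δ_k f|²)^{1/2}]. -/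
open MeasureTheory ENNReal

/-- One-parameter martingale difference operators: `Δ_0 f = 𝔼_0 f` and
`Δ_{k+1} f = 𝔼_{k+1} f − 𝔼_k f`. -/
noncomputable def md {Ω : Type*} [MeasurableSpace Ω] (μ : Measure Ω)
    (𝓕 : ℕ → MeasurableSpace Ω) : ℕ → (Ω → ℝ) → Ω → ℝ
  | 0, f => μ[f|𝓕 0]
  | (k + 1), f => μ[f|𝓕 (k + 1)] - μ[f|𝓕 k]

/-- One step of the pathwise bound of the square function by the maximal function. -/
lemma davis_step_square {x q m d s m' s' : ℝ} (hq : 0 ≤ q) (hx : |x| ≤ m)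
    (hs : 0 ≤ s) (hs2 : s ^ 2 = q + m ^ 2) (hm' : m' = max m |x + d|)
    (hs' : 0 ≤ s') (hs'2 : s' ^ 2 = q + d ^ 2 + m' ^ 2) :
    2 * x / s * d ≤
      ((x + d) ^ 2 / s' - s' + 3 * m') - (x ^ 2 / s - s + 3 * m) := by
  have hm0 : 0 ≤ m := (abs_nonneg x).trans hx
  have hmm' : m ≤ m' := hm' ▸ le_max_left _ _
  have hxm' : |x + d| ≤ m' := hm' ▸ le_max_right _ _
  have hδ : m' - m ≤ |d| := by
    have : m' ≤ m + |d| := by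
      rw [hm']
      exact max_le (by linarith [abs_nonneg d]) ((abs_add_le x d).trans (by linarith))
    linarith
  have hδ2 : (m' - m) ^ 2 ≤ d ^ 2 := by
    rw [← sq_abs d]; exact pow_le_pow_left₀ (by linarith) hδ 2
  have hx'2 : (x + d) ^ 2 ≤ m' ^ 2 := by
    rw [← sq_abs (x + d)]; exact pow_le_pow_left₀ (abs_nonneg _) hxm' 2
  have hms : m ≤ s := abs_le_of_sq_le_sq' (by nlinarith) hs |>.2
  have hms' : m' ≤ s' := abs_le_of_sq_le_sq' (by nlinarith) hs' |>.2
  have hss' : s ≤ s' := abs_le_of_sq_le_sq' (by nlinarith) hs' |>.2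
  rcases hs.eq_or_lt with h0 | hpos
  · subst h0
    have hm : m = 0 := le_antisymm hms hm0
    have hx0 : x = 0 := abs_nonpos_iff.1 (hx.trans hm.le)
    subst hm hx0
    have h1 : s' ≤ 3 * m' := by
      refine abs_le_of_sq_le_sq' ?_ (by linarith) |>.2
      have : d ^ 2 ≤ m' ^ 2 := by simpa using hx'2
      nlinarith
    have h2 : 0 ≤ (0 + d) ^ 2 / s' := by positivity
    simp only [mul_zero, zero_div, zero_mul]
    linarith
  have hpos' : 0 < s' := hpos.trans_le hss'
  have key : 0 ≤ d ^ 2 * s' - (s' - s) * s * s' - (x + d) ^ 2 * (s' - s)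
      + 3 * s * s' * (m' - m) := by
    have a1 : (x + d) ^ 2 * (s' - s) ≤ m' ^ 2 * (s' - s) :=
      mul_le_mul_of_nonneg_right hx'2 (by linarith)
    have a2 : (s' - s) * m ^ 2 ≤ (s' - s) * s ^ 2 :=
      mul_le_mul_of_nonneg_left (by nlinarith) (by linarith)
    have a3 : (s' - s) * s * (s' + s) = s * (d ^ 2 + m' ^ 2 - m ^ 2) := by
      have : s' ^ 2 - s ^ 2 = d ^ 2 + m' ^ 2 - m ^ 2 := by linarith
      rw [← this]; ring
    have a4 : (m' - m) ^ 2 * (s' - s) ≤ d ^ 2 * (s' - s) :=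
      mul_le_mul_of_nonneg_right hδ2 (by linarith)
    have a5 : 0 ≤ s * (m' - m) * (s' - (m' - m)) :=
      mul_nonneg (mul_nonneg hs (by linarith)) (by linarith)
    have a6 : m * ((m' - m) * s') ≤ s * ((m' - m) * s') :=
      mul_le_mul_of_nonneg_right hms (mul_nonneg (by linarith) hs')
    nlinarith
  have e : ((x + d) ^ 2 / s' - s' + 3 * m') - (x ^ 2 / s - s + 3 * m) - 2 * x / s * d =
      (d ^ 2 * s' - (s' - s) * s * s' - (x + d) ^ 2 * (s' - s)
      + 3 * s * s' * (m' - m)) / (s * s') := by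
    field_simp
    ring
  have := div_nonneg key (mul_pos hpos hpos').le
  linarith

/-- One step of the pathwise bound of the maximal function by the square function. -/
lemma davis_step_max {x q m d s r m' s' r' : ℝ} (hq : 0 ≤ q) (hx : |x| ≤ m)
    (hs : 0 ≤ s) (hs2 : s ^ 2 = q + m ^ 2) (hm' : m' = max m |x + d|)
    (hs' : 0 ≤ s') (hs'2 : s' ^ 2 = q + d ^ 2 + m' ^ 2)
    (hr : 0 ≤ r) (hr2 : r ^ 2 = q) (hr' : 0 ≤ r') (hr'2 : r' ^ 2 = q + d ^ 2) :
    ((x + d) ^ 2 / s' + 2 * s' - m' ^ 2 / s' - 20 * r') -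
      (x ^ 2 / s + 2 * s - m ^ 2 / s - 20 * r) ≤ 2 * x / s * d := by
  have hm0 : 0 ≤ m := (abs_nonneg x).trans hx
  have hmm' : m ≤ m' := hm' ▸ le_max_left _ _
  have hms : m ≤ s := abs_le_of_sq_le_sq' (by nlinarith) hs |>.2
  have hss' : s ≤ s' := abs_le_of_sq_le_sq' (by nlinarith) hs' |>.2
  have hrr' : r ≤ r' := abs_le_of_sq_le_sq' (by nlinarith) hr' |>.2
  have hrs : r ≤ s := abs_le_of_sq_le_sq' (by nlinarith) hs |>.2
  have hd0 := abs_nonneg d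
  have hd2 : |d| ^ 2 = d ^ 2 := sq_abs d
  have hr'd : r' ≤ r + |d| := abs_le_of_sq_le_sq' (by nlinarith) (by linarith) |>.2
  have hdr' : |d| ≤ r' := abs_le_of_sq_le_sq' (by nlinarith) hr' |>.2
  have hfac : (r' - r) * (r' + r) = |d| ^ 2 := by nlinarith
  rcases hs.eq_or_lt with h0 | hpos
  · subst h0
    have hm : m = 0 := le_antisymm hms hm0
    have hx0 : x = 0 := abs_nonpos_iff.1 (hx.trans hm.le)
    have hr0 : r = 0 := le_antisymm hrs hr
    subst hm hx0 hr0
    have hm'd : m' = |d| := by rw [hm', zero_add, max_eq_right hd0]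
    have hs'd : s' ≤ 2 * |d| := by
      refine abs_le_of_sq_le_sq' ?_ (by linarith) |>.2
      rw [hm'd] at hs'2
      nlinarith
    have : (0 + d) ^ 2 / s' = m' ^ 2 / s' := by rw [hm'd, zero_add, hd2]
    simp only [this, mul_zero, zero_div, zero_mul]
    linarith
  have hpos' : 0 < s' := hpos.trans_le hss'
  rcases le_total |x + d| m with hc | hc
  · have hmm : m' = m := by rw [hm', max_eq_left hc]
    subst hmm
    have hdm : |d| ≤ 2 * s := by
      have : |d| ≤ |x + d| + |x| := by
        have := abs_sub (x + d) x
        simpa using this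
      linarith
    have hdr : d ^ 2 ≤ 4 * s * (r' - r) := by
      have : (r' - r) * (r' + r) ≤ (r' - r) * (4 * s) :=
        mul_le_mul_of_nonneg_left (by linarith) (by linarith)
      linarith
    have hsd : (s' - s) * (s' + s) = d ^ 2 := by nlinarith
    have key : d ^ 2 * s' + (m' ^ 2 - (x + d) ^ 2) * (s' - s) + 2 * (s' - s) * s * s'
        - 20 * (r' - r) * s * s' ≤ 0 := by
      have b1 : (s' - s) * s ≤ d ^ 2 := by rw [← hsd]; nlinarith
      have b2 : (m' ^ 2 - (x + d) ^ 2) * (s' - s) ≤ s ^ 2 * (s' - s) :=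
        mul_le_mul_of_nonneg_right (by nlinarith [sq_nonneg (x + d)]) (by linarith)
      have b3 : s * ((s' - s) * s) ≤ s' * d ^ 2 :=
        mul_le_mul hss' b1 (mul_nonneg (by linarith) hs) hs'
      have b4 := mul_le_mul_of_nonneg_right b1 hs'
      have b5 := mul_le_mul_of_nonneg_right hdr hs'
      have b6 : 0 ≤ (r' - r) * s * s' := mul_nonneg (mul_nonneg (by linarith) hs) hs'
      nlinarith
    have e : ((x + d) ^ 2 / s' + 2 * s' - m' ^ 2 / s' - 20 * r') -
        (x ^ 2 / s + 2 * s - m' ^ 2 / s - 20 * r) - 2 * x / s * d =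
        (d ^ 2 * s' + (m' ^ 2 - (x + d) ^ 2) * (s' - s) + 2 * (s' - s) * s * s'
        - 20 * (r' - r) * s * s') / (s * s') := by
      field_simp
      ring
    have := div_nonpos_of_nonpos_of_nonneg key (mul_pos hpos hpos').le
    linarith
  · have hmm : m' = |x + d| := by rw [hm', max_eq_right hc]
    have hmm2 : m' ^ 2 = (x + d) ^ 2 := by rw [hmm, sq_abs]
    have key : 2 * d ^ 2 - (s' - s) ^ 2 - 20 * s * (r' - r) ≤ 0 := by
      rcases le_total |d| (4 * s) with hd | hd
      · have c1 : (r' - r) * (r' + r) ≤ (r' - r) * (6 * s) :=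
          mul_le_mul_of_nonneg_left (by linarith) (by linarith)
        have c2 : 0 ≤ (r' - r) * s := mul_nonneg (by linarith) hs
        linarith [sq_nonneg (s' - s)]
      · have c1 : |d| - s ≤ m' := by
          have : |d| ≤ |x + d| + |x| := by
            have := abs_sub (x + d) x
            simpa using this
          linarith
        have c2 : m' ≤ |d| + s := by
          have := abs_add_le x d
          linarith
        have c3 : s' ≤ 2 * s + 2 * |d| := by
          refine abs_le_of_sq_le_sq' ?_ (by linarith) |>.2
          have : m' ^ 2 ≤ (|d| + s) ^ 2 := pow_le_pow_left₀ (hm0.trans hmm') c2 2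
          nlinarith
        have c4 : (|d| - s) ^ 2 ≤ m' ^ 2 := pow_le_pow_left₀ (by linarith) c1 2
        have c5 : |d| ≤ 2 * (r' - r) := by
          refine le_of_mul_le_mul_left ?_ (show 0 < |d| by linarith)
          have : (r' - r) * (r' + r) ≤ (r' - r) * (2 * |d|) :=
            mul_le_mul_of_nonneg_left (by linarith) (by linarith)
          linarith
        have c6 : s * s' ≤ s * (2 * s + 2 * |d|) := mul_le_mul_of_nonneg_left c3 hs
        have c7 : s * |d| ≤ s * (2 * (r' - r)) := mul_le_mul_of_nonneg_left c5 hs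
        have c8 : s * (4 * s) ≤ s * |d| := mul_le_mul_of_nonneg_left hd hs
        linarith [sq_nonneg s]
    have e : ((x + d) ^ 2 / s' + 2 * s' - m' ^ 2 / s' - 20 * r') -
        (x ^ 2 / s + 2 * s - m ^ 2 / s - 20 * r) - 2 * x / s * d =
        (2 * d ^ 2 - (s' - s) ^ 2 - 20 * s * (r' - r)) / s := by
      have hm2 : m ^ 2 = s ^ 2 - s' ^ 2 + d ^ 2 + (x + d) ^ 2 := by linarith
      rw [hmm2, hm2]
      field_simp
      ring
    have := div_nonpos_of_nonpos_of_nonneg key hpos.le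
    linarith

/-- The running maximum of the absolute values of the partial sums of `d`. -/
noncomputable def runningMax (d : ℕ → ℝ) : ℕ → ℝ
  | 0 => 0
  | n + 1 => max (runningMax d n) |∑ i ∈ Finset.range (n + 1), d i|

/-- The running square sum of `d`. -/
noncomputable def squareSum (d : ℕ → ℝ) (n : ℕ) : ℝ := ∑ i ∈ Finset.range n, d i ^ 2

/-- The bounded predictable integrand in the pathwise Davis inequality. -/
noncomputable def davisIntegrand (d : ℕ → ℝ) (n : ℕ) : ℝ :=
  2 * (∑ i ∈ Finset.range n, d i) / √(squareSum d n + runningMax d n ^ 2)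

lemma squareSum_nonneg (d : ℕ → ℝ) (n : ℕ) : 0 ≤ squareSum d n :=
  Finset.sum_nonneg fun _ _ => sq_nonneg _

lemma squareSum_succ (d : ℕ → ℝ) (n : ℕ) : squareSum d (n + 1) = squareSum d n + d n ^ 2 :=
  Finset.sum_range_succ _ _

lemma abs_sum_le_runningMax (d : ℕ → ℝ) (n : ℕ) :
    |∑ i ∈ Finset.range n, d i| ≤ runningMax d n := by
  cases n with
  | zero => simp [runningMax]
  | succ n => exact le_max_right _ _

lemma runningMax_nonneg (d : ℕ → ℝ) (n : ℕ) : 0 ≤ runningMax d n :=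
  (abs_nonneg _).trans (abs_sum_le_runningMax d n)

lemma monotone_runningMax (d : ℕ → ℝ) : Monotone (runningMax d) :=
  monotone_nat_of_le_succ fun _ => le_max_left _ _

lemma monotone_squareSum (d : ℕ → ℝ) : Monotone (squareSum d) :=
  monotone_nat_of_le_succ fun n => by
    rw [squareSum_succ]; exact le_add_of_nonneg_right (sq_nonneg _)

lemma runningMax_le_sum_abs (d : ℕ → ℝ) (n : ℕ) :
    runningMax d n ≤ ∑ i ∈ Finset.range n, |d i| := by
  induction n with
  | zero => simp [runningMax]
  | succ n ih =>
    refine max_le (ih.trans ?_) (Finset.abs_sum_le_sum_abs _ _)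
    rw [Finset.sum_range_succ]
    exact le_add_of_nonneg_right (abs_nonneg _)

lemma sqrt_squareSum_le_sum_abs (d : ℕ → ℝ) (n : ℕ) :
    √(squareSum d n) ≤ ∑ i ∈ Finset.range n, |d i| := by
  refine Real.sqrt_le_iff.2 ⟨Finset.sum_nonneg fun _ _ => abs_nonneg _, ?_⟩
  have := Finset.sum_sq_le_sq_sum_of_nonneg (s := Finset.range n) (f := fun i => |d i|)
    fun _ _ => abs_nonneg _
  simpa [squareSum, sq_abs] using this

lemma abs_davisIntegrand_le (d : ℕ → ℝ) (n : ℕ) : |davisIntegrand d n| ≤ 2 := by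
  rw [davisIntegrand, mul_div_assoc, abs_mul, abs_div, abs_of_nonneg (Real.sqrt_nonneg _), abs_two]
  have h : |∑ i ∈ Finset.range n, d i| ≤ √(squareSum d n + runningMax d n ^ 2) :=
    (abs_sum_le_runningMax d n).trans
      (Real.le_sqrt_of_sq_le (le_add_of_nonneg_left (squareSum_nonneg d n)))
  linarith [div_le_one_of_le₀ h (Real.sqrt_nonneg _)]

/-- Pathwise Davis inequality, bounding the square function. -/
lemma sqrt_squareSum_le (d : ℕ → ℝ) (n : ℕ) :
    √(squareSum d n) ≤
      4 * runningMax d n - ∑ i ∈ Finset.range n, davisIntegrand d i * d i := by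
  have h : ∑ i ∈ Finset.range n, davisIntegrand d i * d i ≤
      (∑ i ∈ Finset.range n, d i) ^ 2 / √(squareSum d n + runningMax d n ^ 2)
        - √(squareSum d n + runningMax d n ^ 2) + 3 * runningMax d n := by
    induction n with
    | zero => simp [runningMax, squareSum]
    | succ n ih =>
      have hq := squareSum_nonneg d n
      have hq' := squareSum_nonneg d (n + 1)
      have step := davis_step_square (m' := runningMax d (n + 1)) (d := d n)
        (s' := √(squareSum d (n + 1) + runningMax d (n + 1) ^ 2))
        hq (abs_sum_le_runningMax d n) (Real.sqrt_nonneg _)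
        (Real.sq_sqrt (by positivity)) (by rw [runningMax, Finset.sum_range_succ])
        (Real.sqrt_nonneg _) (by rw [Real.sq_sqrt (by positivity), squareSum_succ])
      rw [← Finset.sum_range_succ] at step
      rw [Finset.sum_range_succ (fun i => davisIntegrand d i * d i)]
      have : davisIntegrand d n * d n ≤ _ := step
      linarith
  have hq := squareSum_nonneg d n
  have hm := runningMax_nonneg d n
  have h1 : √(squareSum d n) ≤ √(squareSum d n + runningMax d n ^ 2) :=
    Real.sqrt_le_sqrt (le_add_of_nonneg_right (sq_nonneg _))
  have h2 : (∑ i ∈ Finset.range n, d i) ^ 2 / √(squareSum d n + runningMax d n ^ 2) ≤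
      runningMax d n := by
    refine div_le_of_le_mul₀ (Real.sqrt_nonneg _) hm ?_
    rw [← sq_abs, sq]
    have ha := abs_sum_le_runningMax d n
    exact mul_le_mul ha (ha.trans (Real.le_sqrt_of_sq_le (le_add_of_nonneg_left hq)))
      (abs_nonneg _) hm
  linarith

/-- Pathwise Davis inequality, bounding the maximal function. -/
lemma runningMax_le (d : ℕ → ℝ) (n : ℕ) :
    runningMax d n ≤
      20 * √(squareSum d n) + ∑ i ∈ Finset.range n, davisIntegrand d i * d i := by
  have h : (∑ i ∈ Finset.range n, d i) ^ 2 / √(squareSum d n + runningMax d n ^ 2)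
        + 2 * √(squareSum d n + runningMax d n ^ 2)
        - runningMax d n ^ 2 / √(squareSum d n + runningMax d n ^ 2) - 20 * √(squareSum d n) ≤
      ∑ i ∈ Finset.range n, davisIntegrand d i * d i := by
    induction n with
    | zero => simp [runningMax, squareSum]
    | succ n ih =>
      have hq := squareSum_nonneg d n
      have hq' := squareSum_nonneg d (n + 1)
      have step := davis_step_max (m' := runningMax d (n + 1)) (d := d n)
        (s' := √(squareSum d (n + 1) + runningMax d (n + 1) ^ 2))
        (r' := √(squareSum d (n + 1)))
        hq (abs_sum_le_runningMax d n) (Real.sqrt_nonneg _)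
        (Real.sq_sqrt (by positivity)) (by rw [runningMax, Finset.sum_range_succ])
        (Real.sqrt_nonneg _) (by rw [Real.sq_sqrt (by positivity), squareSum_succ])
        (Real.sqrt_nonneg _) (Real.sq_sqrt hq) (Real.sqrt_nonneg _)
        (by rw [Real.sq_sqrt hq', squareSum_succ])
      rw [← Finset.sum_range_succ] at step
      rw [Finset.sum_range_succ (fun i => davisIntegrand d i * d i)]
      have : _ ≤ davisIntegrand d n * d n := step
      linarith
  have hq := squareSum_nonneg d n
  have hm := runningMax_nonneg d n
  have h1 : runningMax d n ≤ √(squareSum d n + runningMax d n ^ 2) :=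
    Real.le_sqrt_of_sq_le (le_add_of_nonneg_left hq)
  have h2 : runningMax d n ^ 2 / √(squareSum d n + runningMax d n ^ 2) ≤ runningMax d n := by
    refine div_le_of_le_mul₀ (Real.sqrt_nonneg _) hm ?_
    simpa only [sq] using mul_le_mul_of_nonneg_left h1 hm
  have h3 : 0 ≤ (∑ i ∈ Finset.range n, d i) ^ 2 / √(squareSum d n + runningMax d n ^ 2) := by
    positivity
  linarith

lemma iSup_ofReal_runningMax (d : ℕ → ℝ) :
    ⨆ n, ENNReal.ofReal (runningMax d n) =
      ⨆ n, (‖∑ i ∈ Finset.range (n + 1), d i‖₊ : ℝ≥0∞) := by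
  have hn : ∀ x : ℝ, (‖x‖₊ : ℝ≥0∞) = ENNReal.ofReal |x| := fun x => by
    rw [← Real.norm_eq_abs, ofReal_norm]; rfl
  simp only [hn]
  apply le_antisymm
  · refine iSup_le fun n => ?_
    induction n with
    | zero => simp [runningMax]
    | succ n ih =>
      rw [runningMax, ENNReal.ofReal_max]
      exact max_le ih (le_iSup (fun n => ENNReal.ofReal |∑ i ∈ Finset.range (n + 1), d i|) n)
  · exact iSup_le fun n => (ENNReal.ofReal_le_ofReal (abs_sum_le_runningMax d (n + 1))).trans
      (le_iSup (fun n => ENNReal.ofReal (runningMax d n)) (n + 1))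

lemma iSup_ofReal_sqrt_squareSum (d : ℕ → ℝ) :
    ⨆ n, ENNReal.ofReal √(squareSum d n) =
      (∑' k, (‖d k‖₊ : ℝ≥0∞) ^ 2) ^ (1 / 2 : ℝ) := by
  have hn : ∀ n, ENNReal.ofReal √(squareSum d n) =
      (∑ k ∈ Finset.range n, (‖d k‖₊ : ℝ≥0∞) ^ 2) ^ (1 / 2 : ℝ) := fun n => by
    rw [Real.sqrt_eq_rpow, ← ENNReal.ofReal_rpow_of_nonneg (squareSum_nonneg d n) (by norm_num),
      squareSum, ENNReal.ofReal_sum_of_nonneg fun _ _ => sq_nonneg _]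
    congr 1
    refine Finset.sum_congr rfl fun k _ => ?_
    rw [← sq_abs, ENNReal.ofReal_pow (abs_nonneg _), ← Real.norm_eq_abs, ofReal_norm]
    rfl
  simp only [hn]
  rw [ENNReal.tsum_eq_iSup_nat]
  exact ((ENNReal.orderIsoRpow (1 / 2) (by norm_num)).map_iSup
    fun n => ∑ k ∈ Finset.range n, (‖d k‖₊ : ℝ≥0∞) ^ 2).symm

section Measurability

variable {Ω : Type*} {m : MeasurableSpace Ω} {d : ℕ → Ω → ℝ}

lemma measurable_runningMax {n : ℕ} (hd : ∀ i < n, Measurable (d i)) :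
    Measurable fun ω => runningMax (fun i => d i ω) n := by
  induction n with
  | zero => exact measurable_const
  | succ n ih =>
    exact (ih fun i hi => hd i (hi.trans n.lt_succ_self)).max
      (Finset.measurable_sum _ fun i hi => hd i (Finset.mem_range.1 hi)).abs

lemma measurable_squareSum {n : ℕ} (hd : ∀ i < n, Measurable (d i)) :
    Measurable fun ω => squareSum (fun i => d i ω) n :=
  Finset.measurable_sum _ fun i hi => (hd i (Finset.mem_range.1 hi)).pow_const 2

lemma measurable_davisIntegrand {n : ℕ} (hd : ∀ i < n, Measurable (d i)) :
    Measurable fun ω => davisIntegrand (fun i => d i ω) n :=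
  ((Finset.measurable_sum _ fun i hi => hd i (Finset.mem_range.1 hi)).const_mul 2).div
    ((measurable_squareSum hd).add ((measurable_runningMax hd).pow_const 2)).sqrt

end Measurability

section MartingaleDifferences

variable {Ω : Type*} [m0 : MeasurableSpace Ω] {μ : Measure Ω} {𝓕 : ℕ → MeasurableSpace Ω}

lemma sum_md (f : Ω → ℝ) (n : ℕ) (ω : Ω) :
    ∑ k ∈ Finset.range (n + 1), md μ 𝓕 k f ω = (μ[f|𝓕 n]) ω := by
  induction n with
  | zero => simp [md]
  | succ n ih => rw [Finset.sum_range_succ, ih]; simp [md]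

lemma measurable_md (hmono : Monotone 𝓕) (f : Ω → ℝ) {k n : ℕ} (hkn : k ≤ n) :
    Measurable[𝓕 n] (md μ 𝓕 k f) := by
  cases k with
  | zero => exact (stronglyMeasurable_condExp.mono (hmono hkn)).measurable
  | succ k =>
    exact ((stronglyMeasurable_condExp.mono (hmono hkn)).sub
      (stronglyMeasurable_condExp.mono (hmono (k.le_succ.trans hkn)))).measurable

lemma integrable_md (f : Ω → ℝ) (k : ℕ) : Integrable (md μ 𝓕 k f) μ := by
  cases k with
  | zero => exact integrable_condExp
  | succ k => exact integrable_condExp.sub integrable_condExp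

lemma condExp_md_succ [IsProbabilityMeasure μ] (hle : ∀ k, 𝓕 k ≤ m0)
    (hmono : Monotone 𝓕) (f : Ω → ℝ) (k : ℕ) :
    μ[md μ 𝓕 (k + 1) f|𝓕 k] =ᵐ[μ] 0 := by
  have h1 := condExp_sub (μ := μ) (integrable_condExp (f := f) (m := 𝓕 (k + 1)))
    (integrable_condExp (f := f) (m := 𝓕 k)) (𝓕 k)
  have h2 := condExp_condExp_of_le (μ := μ) (f := f) (hmono k.le_succ) (hle (k + 1))
  have h3 := condExp_condExp_of_le (μ := μ) (f := f) (le_refl (𝓕 k)) (hle k)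
  filter_upwards [h1, h2, h3] with ω h1 h2 h3
  exact h1.trans (by simp [h2, h3])

lemma integrable_davisIntegrand_mul_md (hle : ∀ k, 𝓕 k ≤ m0) (hmono : Monotone 𝓕)
    (f : Ω → ℝ) (n : ℕ) :
    Integrable (fun ω => davisIntegrand (fun k => md μ 𝓕 k f ω) n * md μ 𝓕 n f ω) μ :=
  (integrable_md f n).bdd_mul
    (measurable_davisIntegrand fun k _ =>
      (measurable_md hmono f le_rfl).mono (hle k) le_rfl).aestronglyMeasurable
    (Filter.Eventually.of_forall fun _ => abs_davisIntegrand_le _ n)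

lemma integral_davisIntegrand_mul_md [IsProbabilityMeasure μ] (hle : ∀ k, 𝓕 k ≤ m0)
    (hmono : Monotone 𝓕) (f : Ω → ℝ) (n : ℕ) :
    ∫ ω, davisIntegrand (fun k => md μ 𝓕 k f ω) n * md μ 𝓕 n f ω ∂μ = 0 := by
  cases n with
  | zero => simp [davisIntegrand]
  | succ n =>
    have hpull := condExp_mul_of_stronglyMeasurable_left (μ := μ) (m := 𝓕 n)
      (measurable_davisIntegrand (m := 𝓕 n) (n := n + 1) fun k hk =>
        measurable_md (μ := μ) hmono f (Nat.lt_succ_iff.1 hk)).stronglyMeasurable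
      (integrable_davisIntegrand_mul_md hle hmono f (n + 1)) (integrable_md f (n + 1))
    rw [← integral_condExp (hle n)]
    refine integral_eq_zero_of_ae ?_
    filter_upwards [hpull, condExp_md_succ hle hmono f n] with ω h1 h2
    exact h1.trans (by simp [h2])

lemma integral_sum_davisIntegrand_mul_md [IsProbabilityMeasure μ] (hle : ∀ k, 𝓕 k ≤ m0)
    (hmono : Monotone 𝓕) (f : Ω → ℝ) (n : ℕ) :
    ∫ ω, ∑ i ∈ Finset.range n,
      davisIntegrand (fun k => md μ 𝓕 k f ω) i * md μ 𝓕 i f ω ∂μ = 0 := by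
  rw [integral_finsetSum _ fun i _ => integrable_davisIntegrand_mul_md hle hmono f i]
  exact Finset.sum_eq_zero fun i _ => integral_davisIntegrand_mul_md hle hmono f i

lemma integrable_runningMax_md (hle : ∀ k, 𝓕 k ≤ m0) (hmono : Monotone 𝓕)
    (f : Ω → ℝ) (n : ℕ) :
    Integrable (fun ω => runningMax (fun k => md μ 𝓕 k f ω) n) μ :=
  (integrable_finsetSum (Finset.range n) fun i _ => (integrable_md f i).abs).mono'
    (measurable_runningMax fun k _ =>
      (measurable_md hmono f le_rfl).mono (hle k) le_rfl).aestronglyMeasurable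
    (Filter.Eventually.of_forall fun ω => by
      rw [Real.norm_of_nonneg (runningMax_nonneg _ n)]
      exact runningMax_le_sum_abs _ n)

lemma integrable_sqrt_squareSum_md (hle : ∀ k, 𝓕 k ≤ m0) (hmono : Monotone 𝓕)
    (f : Ω → ℝ) (n : ℕ) :
    Integrable (fun ω => √(squareSum (fun k => md μ 𝓕 k f ω) n)) μ :=
  (integrable_finsetSum (Finset.range n) fun i _ => (integrable_md f i).abs).mono'
    (measurable_squareSum fun k _ =>
      (measurable_md hmono f le_rfl).mono (hle k) le_rfl).sqrt.aestronglyMeasurable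
    (Filter.Eventually.of_forall fun ω => by
      rw [Real.norm_of_nonneg (Real.sqrt_nonneg _)]
      exact sqrt_squareSum_le_sum_abs _ n)

lemma integral_sqrt_squareSum_md_le [IsProbabilityMeasure μ] (hle : ∀ k, 𝓕 k ≤ m0)
    (hmono : Monotone 𝓕) (f : Ω → ℝ) (n : ℕ) :
    ∫ ω, √(squareSum (fun k => md μ 𝓕 k f ω) n) ∂μ ≤
      4 * ∫ ω, runningMax (fun k => md μ 𝓕 k f ω) n ∂μ := by
  have hM := (integrable_runningMax_md (μ := μ) hle hmono f n).const_mul 4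
  have hH := integrable_finsetSum (Finset.range n) fun i _ =>
    integrable_davisIntegrand_mul_md (μ := μ) hle hmono f i
  have h := integral_mono (integrable_sqrt_squareSum_md (μ := μ) hle hmono f n) (hM.sub hH)
    fun ω => sqrt_squareSum_le (fun k => md μ 𝓕 k f ω) n
  rwa [integral_sub' hM hH, integral_const_mul,
    integral_sum_davisIntegrand_mul_md hle hmono, sub_zero] at h

lemma integral_runningMax_md_le [IsProbabilityMeasure μ] (hle : ∀ k, 𝓕 k ≤ m0)
    (hmono : Monotone 𝓕) (f : Ω → ℝ) (n : ℕ) :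
    ∫ ω, runningMax (fun k => md μ 𝓕 k f ω) n ∂μ ≤
      20 * ∫ ω, √(squareSum (fun k => md μ 𝓕 k f ω) n) ∂μ := by
  have hS := (integrable_sqrt_squareSum_md (μ := μ) hle hmono f n).const_mul 20
  have hH := integrable_finsetSum (Finset.range n) fun i _ =>
    integrable_davisIntegrand_mul_md (μ := μ) hle hmono f i
  have h := integral_mono (integrable_runningMax_md (μ := μ) hle hmono f n) (hS.add hH)
    fun ω => runningMax_le (fun k => md μ 𝓕 k f ω) n
  rwa [integral_add' hS hH, integral_const_mul,
    integral_sum_davisIntegrand_mul_md hle hmono, add_zero] at h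

end MartingaleDifferences

/-- An inequality between integrals of increasing sequences passes to their suprema. -/
lemma lintegral_iSup_ofReal_le {Ω : Type*} [MeasurableSpace Ω] {μ : Measure Ω}
    {u v : ℕ → Ω → ℝ} {K : ℝ} (hK : 0 ≤ K) (hu : ∀ n, Integrable (u n) μ)
    (hv : ∀ n, Integrable (v n) μ) (hu0 : ∀ n ω, 0 ≤ u n ω) (hv0 : ∀ n ω, 0 ≤ v n ω)
    (hmono : ∀ ω, Monotone fun n => u n ω) (h : ∀ n, ∫ ω, u n ω ∂μ ≤ K * ∫ ω, v n ω ∂μ) :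
    ∫⁻ ω, ⨆ n, ENNReal.ofReal (u n ω) ∂μ ≤
      ENNReal.ofReal K * ∫⁻ ω, ⨆ n, ENNReal.ofReal (v n ω) ∂μ := by
  rw [lintegral_iSup' (fun n => (hu n).aestronglyMeasurable.aemeasurable.ennreal_ofReal)
    (Filter.Eventually.of_forall fun ω _ _ hij => ENNReal.ofReal_le_ofReal (hmono ω hij))]
  refine iSup_le fun n => ?_
  calc ∫⁻ ω, ENNReal.ofReal (u n ω) ∂μ = ENNReal.ofReal (∫ ω, u n ω ∂μ) :=
        (ofReal_integral_eq_lintegral_ofReal (hu n)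
          (Filter.Eventually.of_forall (hu0 n))).symm
    _ ≤ ENNReal.ofReal K * ENNReal.ofReal (∫ ω, v n ω ∂μ) := by
        rw [← ENNReal.ofReal_mul hK]
        exact ENNReal.ofReal_le_ofReal (h n)
    _ = ENNReal.ofReal K * ∫⁻ ω, ENNReal.ofReal (v n ω) ∂μ := by
        rw [ofReal_integral_eq_lintegral_ofReal (hv n) (Filter.Eventually.of_forall (hv0 n))]
    _ ≤ _ := by
        gcongr
        exact le_iSup (fun n => ENNReal.ofReal (v n _)) n

/-- Davis inequality: for any filtration `(ℱ_k)` with `ℱ_0 = {∅, Ω}` on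
any probability space and any `f ∈ L¹(⋁_k ℱ_k)`, with universal two-sided constants,
`𝔼[sup_n |𝔼_n f|] ≃ 𝔼[(Σ_k |Δ_k f|²)^{1/2}]`. -/
theorem davis_inequality :
    ∃ c C : ℝ≥0∞, 0 < c ∧ C ≠ ∞ ∧
      ∀ (Ω : Type*) [m0 : MeasurableSpace Ω] (μ : Measure Ω) [IsProbabilityMeasure μ]
        (𝓕 : ℕ → MeasurableSpace Ω), (∀ k, 𝓕 k ≤ m0) → Monotone 𝓕 → 𝓕 0 = ⊥ →
        ∀ f : Ω → ℝ, Integrable f μ → Measurable[(⨆ k, 𝓕 k)] f →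
          c * ∫⁻ ω, (∑' k : ℕ, (‖md μ 𝓕 k f ω‖₊ : ℝ≥0∞) ^ 2) ^ (1/2 : ℝ) ∂μ ≤
              ∫⁻ ω, ⨆ n, (‖(μ[f|𝓕 n]) ω‖₊ : ℝ≥0∞) ∂μ ∧
            ∫⁻ ω, ⨆ n, (‖(μ[f|𝓕 n]) ω‖₊ : ℝ≥0∞) ∂μ ≤
              C * ∫⁻ ω, (∑' k : ℕ, (‖md μ 𝓕 k f ω‖₊ : ℝ≥0∞) ^ 2) ^ (1/2 : ℝ) ∂μ := by
  refine ⟨(ENNReal.ofReal 4)⁻¹, ENNReal.ofReal 20, ENNReal.inv_pos.2 ENNReal.ofReal_ne_top,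
    ENNReal.ofReal_ne_top, ?_⟩
  intro Ω m0 μ _ 𝓕 hle hmono _ f _ _
  have hM : ∀ ω, ⨆ n, (‖(μ[f|𝓕 n]) ω‖₊ : ℝ≥0∞) =
      ⨆ n, ENNReal.ofReal (runningMax (fun k => md μ 𝓕 k f ω) n) := fun ω => by
    simp only [iSup_ofReal_runningMax, sum_md]
  simp only [hM, ← iSup_ofReal_sqrt_squareSum]
  have intM := integrable_runningMax_md (μ := μ) hle hmono f
  have intS := integrable_sqrt_squareSum_md (μ := μ) hle hmono f
  constructor
  · rw [mul_comm, ← div_eq_mul_inv]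
    refine ENNReal.div_le_of_le_mul' ?_
    exact lintegral_iSup_ofReal_le (by norm_num) intS intM (fun _ _ => Real.sqrt_nonneg _)
      (fun n _ => runningMax_nonneg _ n)
      (fun _ _ _ hij => Real.sqrt_le_sqrt (monotone_squareSum _ hij))
      (integral_sqrt_squareSum_md_le hle hmono f)
  · exact lintegral_iSup_ofReal_le (by norm_num) intM intS (fun n _ => runningMax_nonneg _ n)
      (fun _ _ => Real.sqrt_nonneg _) (fun _ => monotone_runningMax _)
      (integral_runningMax_md_le hle hmono f)
end
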